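/- arXiv:2211.15232 — 2 statements merged into one kernel-verified Lean document; each statement's English description precedes it below -/
import Mathlib

section
/- Assume μ has finite second moment and σ is X-controlled, and let A be the limit covariance matrix, i.e. the positive semidefinite symmetric matrix such that (1/n) ∫_G σ(g,x) σ(g,x)ᵀ dμ^{*n}(g) → A uniformly in x. Then, uniformly in x ∈ X, the law of σ(g,x)/√n under μ^{*n} converges weakly to the centered Gaussian distribution 𝒩(0,A) on ℝ^d: for every bounded continuous function f : ℝ^d → ℝ, sup_{x∈X} |∫_G f(σ(g,x)/√n) dμ^{*n}(g) − ∫_{ℝ^d} f d𝒩(0,A)| → 0 as n → ∞. -/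
open MeasureTheory Filter Topology
open scoped ENNReal NNReal

noncomputable section

/-- The group element `b_n ⋯ b_1`, where `b_i` is coordinate `i - 1` of `b`. -/
def prodRev {G : Type*} [Monoid G] (b : ℕ → G) : ℕ → G
  | 0 => 1
  | n + 1 => b n * prodRev b n

/-- The `n`-th convolution power of `μ`: the law of `b_n ⋯ b_1` for i.i.d. `b_i` of law `μ`. -/
def convPow {G : Type*} [Monoid G] [MeasurableSpace G] (μ : Measure G) : ℕ → Measure G
  | 0 => Measure.dirac 1
  | n + 1 => (μ.prod (convPow μ n)).map fun p => p.1 * p.2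

/-- The σ-algebra on `ℕ → G` generated by the first `k` coordinates. -/
def coordSA (G : Type*) [MeasurableSpace G] (k : ℕ) : MeasurableSpace (ℕ → G) :=
  MeasurableSpace.comap (fun b (i : Fin k) => b i) MeasurableSpace.pi

set_option linter.unusedSectionVars false

section Helpers

variable {G : Type*} [Group G] [MeasurableSpace G] [MeasurableMul₂ G]

lemma convPow_succ_mconv (μ : Measure G) (n : ℕ) :
    convPow μ (n + 1) = Measure.mconv μ (convPow μ n) := rfl

instance convPow_prob (μ : Measure G) [IsProbabilityMeasure μ] (n : ℕ) :
    IsProbabilityMeasure (convPow μ n) := by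
  induction n with
  | zero => exact Measure.dirac.isProbabilityMeasure
  | succ n ih => rw [convPow_succ_mconv]; infer_instance

lemma convPow_add (μ : Measure G) [IsProbabilityMeasure μ] (m n : ℕ) :
    convPow μ (m + n) = Measure.mconv (convPow μ m) (convPow μ n) := by
  induction m with
  | zero =>
    rw [Nat.zero_add]
    exact (Measure.dirac_one_mconv _).symm
  | succ m ih =>
    rw [show m + 1 + n = (m + n) + 1 by ring, convPow_succ_mconv, ih, convPow_succ_mconv,
      Measure.mconv_assoc]

lemma memLp_convPow (μ : Measure G) [IsProbabilityMeasure μ] (M : G → ℝ) (hM : Measurable M)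
    (hM0 : ∀ g, 0 ≤ M g) (hsub : ∀ g h, M (g * h) ≤ M g + M h) (h2 : MemLp M 2 μ) (n : ℕ) :
    MemLp M 2 (convPow μ n) := by
  induction n with
  | zero =>
    refine MemLp.of_bound hM.aestronglyMeasurable (M 1) ?_
    change ∀ᵐ g ∂(Measure.dirac 1), _
    rw [ae_dirac_iff (measurableSet_le (by fun_prop) (by fun_prop))]
    simp [abs_of_nonneg (hM0 1)]
  | succ n ih =>
    rw [convPow_succ_mconv, Measure.mconv, memLp_map_measure_iff hM.aestronglyMeasurable
      (by fun_prop)]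
    have h : MemLp (fun p : G × G => M p.1 + M p.2) 2 (μ.prod (convPow μ n)) :=
      (h2.comp_measurePreserving measurePreserving_fst).add
        (ih.comp_measurePreserving measurePreserving_snd)
    refine h.mono (hM.comp measurable_mul).aestronglyMeasurable (Eventually.of_forall ?_)
    intro p
    simp only [Function.comp, Real.norm_eq_abs]
    rw [abs_of_nonneg (hM0 _), abs_of_nonneg (add_nonneg (hM0 _) (hM0 _))]
    exact hsub _ _

lemma exp_taylor_bound (u : ℝ) :
    ‖Complex.exp (Complex.I * u) - (1 + Complex.I * u - (u : ℂ) ^ 2 / 2)‖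
      ≤ 4 * u ^ 2 * min 1 |u| := by
  rcases le_total |u| 1 with h | h
  · rw [min_eq_right h]
    have := Complex.exp_bound (x := Complex.I * u) (by simpa using h) (n := 3) (by norm_num)
    simp only [Finset.sum_range_succ, Finset.sum_range_zero] at this
    norm_num [Nat.factorial, mul_pow] at this
    have e : Complex.exp (Complex.I * u) - (1 + Complex.I * u - (u : ℂ) ^ 2 / 2)
      = Complex.exp (Complex.I * u) - (1 + Complex.I * u + -(u : ℂ) ^ 2 / 2) := by ring
    rw [e]
    refine this.trans ?_
    have : |u| ^ 3 = u ^ 2 * |u| := by rw [← sq_abs u]; ring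
    rw [this]
    nlinarith [mul_nonneg (sq_nonneg u) (abs_nonneg u)]
  · rw [min_eq_left h]
    have h1 : ‖Complex.exp (Complex.I * u)‖ = 1 := Complex.norm_exp_I_mul_ofReal u
    have h2 : ‖Complex.exp (Complex.I * u) - (1 + Complex.I * u - (u : ℂ) ^ 2 / 2)‖
        ≤ 1 + (1 + |u| + u ^ 2 / 2) := by
      refine (norm_sub_le _ _).trans ?_
      rw [h1]
      gcongr
      refine (norm_sub_le _ _).trans ?_
      gcongr
      · refine (norm_add_le _ _).trans ?_
        simp
      · simp
    refine h2.trans ?_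
    rw [← sq_abs u]
    nlinarith

variable {X : Type*} [MeasurableSpace X] [MulAction G X]

/-- characteristic function of the cocycle at time `n` -/
def phiC (μ : Measure G) (τ : G → X → ℝ) (s : ℝ) (n : ℕ) (x : X) : ℂ :=
  ∫ g, Complex.exp (Complex.I * ((s * τ g x : ℝ) : ℂ)) ∂(convPow μ n)

lemma meas_sec {E : Type*} [MeasurableSpace E] {τ : G → X → E}
    (hτ : Measurable fun p : G × X => τ p.1 p.2) (x : X) :
    Measurable fun g => τ g x := hτ.comp (measurable_id.prodMk measurable_const)

lemma drift_convPow (hact : Measurable fun p : G × X => p.1 • p.2)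
    (μ : Measure G) [IsProbabilityMeasure μ] (τ : G → X → ℝ)
    (hτ : Measurable fun p : G × X => τ p.1 p.2)
    (hcoc : ∀ g₁ g₂ : G, ∀ x : X, τ (g₂ * g₁) x = τ g₂ (g₁ • x) + τ g₁ x)
    (M : G → ℝ) (hM : Measurable M)
    (hM0 : ∀ g, 0 ≤ M g) (hsub : ∀ g h, M (g * h) ≤ M g + M h) (h2 : MemLp M 2 μ)
    (hle : ∀ g x, |τ g x| ≤ M g) (hdrift : ∀ x, ∫ g, τ g x ∂μ = 0) (n : ℕ) (x : X) :
    ∫ g, τ g x ∂(convPow μ n) = 0 := by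
  have hint : ∀ n x, Integrable (fun g => τ g x) (convPow μ n) := fun n x =>
    ((memLp_convPow μ M hM hM0 hsub h2 n).integrable (by norm_num)).mono'
      (meas_sec hτ x).aestronglyMeasurable (Eventually.of_forall fun g => hle g x)
  induction n with
  | zero =>
    have h1 : τ 1 x = 0 := by simpa using hcoc 1 1 x
    change ∫ g, τ g x ∂(Measure.dirac 1) = 0
    rw [integral_dirac' _ _ (meas_sec hτ x).stronglyMeasurable, h1]
  | succ n ih =>
    have hi := hint (n + 1) x
    have hm : Measurable fun p : G × G => τ p.1 (p.2 • x) :=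
      hτ.comp (measurable_fst.prodMk (hact.comp (measurable_snd.prodMk measurable_const)))
    have i1 : Integrable (fun p : G × G => τ p.1 (p.2 • x)) (μ.prod (convPow μ n)) := by
      have : Integrable (fun p : G × G => M p.1) (μ.prod (convPow μ n)) :=
        (h2.integrable (by norm_num)).comp_fst _
      exact this.mono' hm.aestronglyMeasurable (Eventually.of_forall fun g => hle _ _)
    have i2 : Integrable (fun p : G × G => τ p.2 x) (μ.prod (convPow μ n)) :=
      (hint n x).comp_snd _
    rw [convPow_succ_mconv, Measure.mconv, integral_map (by fun_prop)
      (meas_sec hτ x).aestronglyMeasurable]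
    simp_rw [hcoc]
    rw [integral_add i1 i2, integral_prod_symm _ i1]
    simp only [hdrift, integral_zero, zero_add]
    rw [integral_prod_symm _ i2]
    simpa using ih

lemma phiC_norm_integrand (τ : G → X → ℝ) (s : ℝ) (g : G) (x : X) :
    ‖Complex.exp (Complex.I * ((s * τ g x : ℝ) : ℂ))‖ = 1 := Complex.norm_exp_I_mul_ofReal _

lemma phiC_add (hact : Measurable fun p : G × X => p.1 • p.2)
    (μ : Measure G) [IsProbabilityMeasure μ] (τ : G → X → ℝ)
    (hτ : Measurable fun p : G × X => τ p.1 p.2)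
    (hcoc : ∀ g₁ g₂ : G, ∀ x : X, τ (g₂ * g₁) x = τ g₂ (g₁ • x) + τ g₁ x)
    (s : ℝ) (n m : ℕ) (x : X) :
    phiC μ τ s (n + m) x = ∫ g, Complex.exp (Complex.I * ((s * τ g x : ℝ) : ℂ))
      * phiC μ τ s n (g • x) ∂(convPow μ m) := by
  have hsec := meas_sec hτ x
  have hm : Measurable fun p : G × G => τ p.1 (p.2 • x) :=
      hτ.comp (measurable_fst.prodMk (hact.comp (measurable_snd.prodMk measurable_const)))
  unfold phiC
  rw [convPow_add, Measure.mconv, integral_map (by fun_prop)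
    (Measurable.aestronglyMeasurable (by fun_prop))]
  rw [integral_prod_symm]
  · refine integral_congr_ae (Eventually.of_forall fun g => ?_)
    simp only [hcoc]
    rw [← integral_const_mul]
    refine integral_congr_ae (Eventually.of_forall fun h => ?_)
    simp only
    rw [← Complex.exp_add]
    congr 1
    push_cast
    ring
  · refine Integrable.of_bound (C := 1) (Measurable.aestronglyMeasurable (by fun_prop)) ?_
    exact Eventually.of_forall fun p => (phiC_norm_integrand τ s _ x).le

lemma phiC_meas (hact : Measurable fun p : G × X => p.1 • p.2)
    (μ : Measure G) [IsProbabilityMeasure μ] (τ : G → X → ℝ)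
    (hτ : Measurable fun p : G × X => τ p.1 p.2) (s : ℝ) (n : ℕ) (x : X) :
    Measurable fun g : G => phiC μ τ s n (g • x) := by
  have hm : Measurable fun p : G × G => τ p.2 (p.1 • x) :=
      hτ.comp (measurable_snd.prodMk (hact.comp (measurable_fst.prodMk measurable_const)))
  have : StronglyMeasurable (fun p : G × G =>
    Complex.exp (Complex.I * ((s * τ p.2 (p.1 • x) : ℝ) : ℂ))) :=
    Measurable.stronglyMeasurable (by fun_prop)
  exact (this.integral_prod_right (ν := convPow μ n)).measurable

lemma phiC_iterate (hact : Measurable fun p : G × X => p.1 • p.2)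
    (μ : Measure G) [IsProbabilityMeasure μ] (τ : G → X → ℝ)
    (hτ : Measurable fun p : G × X => τ p.1 p.2)
    (hcoc : ∀ g₁ g₂ : G, ∀ x : X, τ (g₂ * g₁) x = τ g₂ (g₁ • x) + τ g₁ x)
    (s : ℝ) (m r : ℕ) (a : ℂ) (ha : ‖a‖ ≤ 1) (δ η : ℝ)
    (hδ : ∀ x, ‖phiC μ τ s m x - a‖ ≤ δ) (hη : ∀ x, ‖phiC μ τ s r x - 1‖ ≤ η) (k : ℕ) (x : X) :
    ‖phiC μ τ s (k * m + r) x - a ^ k‖ ≤ k * δ + η := by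
  induction k generalizing x with
  | zero => simpa using hη x
  | succ k ih =>
    have hsec := meas_sec hτ x
    have hpm := phiC_meas hact μ τ hτ s (k * m + r) x
    have hie : Integrable (fun g => Complex.exp (Complex.I * ((s * τ g x : ℝ) : ℂ)))
        (convPow μ m) := by
      refine Integrable.of_bound (C := 1) (Measurable.aestronglyMeasurable (by fun_prop)) ?_
      exact Eventually.of_forall fun p => (phiC_norm_integrand τ s _ x).le
    have hb : ∀ g : G, ‖Complex.exp (Complex.I * ((s * τ g x : ℝ) : ℂ))
      * (phiC μ τ s (k * m + r) (g • x) - a ^ k)‖ ≤ k * δ + η := fun g => by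
        rw [norm_mul, phiC_norm_integrand, one_mul]; exact ih _
    have hi2 : Integrable (fun g => Complex.exp (Complex.I * ((s * τ g x : ℝ) : ℂ))
      * (phiC μ τ s (k * m + r) (g • x) - a ^ k)) (convPow μ m) := by
      refine Integrable.of_bound (C := k * δ + η) (Measurable.aestronglyMeasurable (by fun_prop)) ?_
      exact Eventually.of_forall hb
    rw [show (k + 1) * m + r = (k * m + r) + m by ring, phiC_add hact μ τ hτ hcoc]
    have e : ∫ g, Complex.exp (Complex.I * ((s * τ g x : ℝ) : ℂ))
      * phiC μ τ s (k * m + r) (g • x) ∂(convPow μ m) - a ^ (k + 1)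
      = ∫ g, Complex.exp (Complex.I * ((s * τ g x : ℝ) : ℂ))
      * (phiC μ τ s (k * m + r) (g • x) - a ^ k) ∂(convPow μ m)
        + (phiC μ τ s m x - a) * a ^ k := by
      have : phiC μ τ s m x * a ^ k = ∫ g, Complex.exp (Complex.I * ((s * τ g x : ℝ) : ℂ)) * a ^ k
        ∂(convPow μ m) := by rw [integral_mul_const]; rfl
      rw [sub_mul, this, add_sub, ← integral_add hi2 (hie.mul_const _)]
      congr 1
      · congr 1
        ext g
        ring
      · ring
    rw [e]
    refine (norm_add_le _ _).trans ?_
    have h1 := norm_integral_le_of_norm_le_const (μ := convPow μ m) (Eventually.of_forall hb)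
    have h2 : ‖(phiC μ τ s m x - a) * a ^ k‖ ≤ δ := by
      rw [norm_mul, norm_pow]
      exact (mul_le_of_le_one_right (norm_nonneg _) (pow_le_one₀ (norm_nonneg _) ha)).trans (hδ x)
    simp only [probReal_univ, mul_one] at h1
    rw [Nat.cast_succ]
    linarith

lemma phiC_sub_one (μ : Measure G) [IsProbabilityMeasure μ] (τ : G → X → ℝ)
    (hτ : Measurable fun p : G × X => τ p.1 p.2) (M : G → ℝ)
    (s : ℝ) (hs : 0 ≤ s) (n : ℕ) (hM : Integrable M (convPow μ n))
    (hle : ∀ g x, |τ g x| ≤ M g) (x : X) :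
    ‖phiC μ τ s n x - 1‖ ≤ s * ∫ g, M g ∂(convPow μ n) := by
  have hsec := meas_sec hτ x
  have hie : Integrable (fun g => Complex.exp (Complex.I * ((s * τ g x : ℝ) : ℂ)))
        (convPow μ n) := by
      refine Integrable.of_bound (C := 1) (Measurable.aestronglyMeasurable (by fun_prop)) ?_
      exact Eventually.of_forall fun p => (phiC_norm_integrand τ s _ x).le
  have e : phiC μ τ s n x - 1 = ∫ g, (Complex.exp (Complex.I * ((s * τ g x : ℝ) : ℂ)) - 1)
      ∂(convPow μ n) := by
    rw [integral_sub hie (integrable_const _)]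
    simp [phiC]
  rw [e, ← integral_const_mul]
  refine norm_integral_le_of_norm_le (hM.const_mul _) (Eventually.of_forall fun g => ?_)
  refine Real.norm_exp_I_mul_ofReal_sub_one_le.trans ?_
  rw [Real.norm_eq_abs, abs_mul, abs_of_nonneg hs]
  exact mul_le_mul_of_nonneg_left (hle g x) hs

lemma phiC_block (μ : Measure G) [IsProbabilityMeasure μ] (τ : G → X → ℝ)
    (hτ : Measurable fun p : G × X => τ p.1 p.2) (M : G → ℝ) (hMm : Measurable M)
    (hM0 : ∀ g, 0 ≤ M g)
    (s : ℝ) (hs : 0 ≤ s) (n : ℕ) (hM : MemLp M 2 (convPow μ n))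
    (hle : ∀ g x, |τ g x| ≤ M g) (x : X) (hdr : ∫ g, τ g x ∂(convPow μ n) = 0) :
    ‖phiC μ τ s n x - ((1 - s ^ 2 / 2 * ∫ g, τ g x ^ 2 ∂(convPow μ n) : ℝ) : ℂ)‖
      ≤ s ^ 2 * ∫ g, 4 * M g ^ 2 * min 1 (s * M g) ∂(convPow μ n) := by
  have hsec := meas_sec hτ x
  have hie : Integrable (fun g => Complex.exp (Complex.I * ((s * τ g x : ℝ) : ℂ)))
        (convPow μ n) := by
      refine Integrable.of_bound (C := 1) (Measurable.aestronglyMeasurable (by fun_prop)) ?_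
      exact Eventually.of_forall fun p => (phiC_norm_integrand τ s _ x).le
  have hτ2 : MemLp (fun g => τ g x) 2 (convPow μ n) :=
    hM.mono hsec.aestronglyMeasurable (Eventually.of_forall fun g => by
      rw [Real.norm_eq_abs, Real.norm_eq_abs, abs_of_nonneg (hM0 g)]; exact hle g x)
  have i1 : Integrable (fun g => τ g x) (convPow μ n) := hτ2.integrable (by norm_num)
  have i2 : Integrable (fun g => τ g x ^ 2) (convPow μ n) := hτ2.integrable_sq
  have i3 : Integrable (fun g => 1 - s ^ 2 / 2 * τ g x ^ 2) (convPow μ n) :=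
    (integrable_const _).sub (i2.const_mul _)
  have i4 : Integrable (fun g => s * τ g x) (convPow μ n) := i1.const_mul _
  have i5 : Integrable (fun g => 4 * M g ^ 2 * min 1 (s * M g)) (convPow μ n) := by
    refine (hM.integrable_sq.const_mul 4).mono' (Measurable.aestronglyMeasurable (by fun_prop))
      (Eventually.of_forall fun g => ?_)
    have : 0 ≤ min 1 (s * M g) := le_min zero_le_one (mul_nonneg hs (hM0 g))
    rw [Real.norm_eq_abs, abs_of_nonneg (by positivity)]
    exact mul_le_of_le_one_right (by positivity) (min_le_left _ _)
  have e3 : ((1 - s ^ 2 / 2 * ∫ g, τ g x ^ 2 ∂(convPow μ n) : ℝ) : ℂ)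
      = ∫ g, (((1 - s ^ 2 / 2 * τ g x ^ 2 : ℝ) : ℂ) + Complex.I * ((s * τ g x : ℝ) : ℂ))
        ∂(convPow μ n) := by
    rw [integral_add i3.ofReal (i4.ofReal.const_mul _), integral_const_mul]
    rw [integral_complex_ofReal, integral_complex_ofReal, integral_const_mul s, hdr,
      integral_sub (integrable_const _) (i2.const_mul _), integral_const_mul]
    simp
  have i6 : Integrable (fun g => (((1 - s ^ 2 / 2 * τ g x ^ 2 : ℝ) : ℂ)
      + Complex.I * ((s * τ g x : ℝ) : ℂ))) (convPow μ n) :=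
    i3.ofReal.add (i4.ofReal.const_mul _)
  rw [e3, phiC, ← integral_sub hie i6, ← integral_const_mul]
  refine norm_integral_le_of_norm_le (i5.const_mul _) (Eventually.of_forall fun g => ?_)
  have := exp_taylor_bound (s * τ g x)
  have e : (((1 - s ^ 2 / 2 * τ g x ^ 2 : ℝ) : ℂ) + Complex.I * ((s * τ g x : ℝ) : ℂ))
    = (1 + Complex.I * ((s * τ g x : ℝ) : ℂ) - ((s * τ g x : ℝ) : ℂ) ^ 2 / 2) := by
    push_cast; ring
  rw [e]
  refine this.trans ?_
  have hu : |s * τ g x| ≤ s * M g := by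
    rw [abs_mul, abs_of_nonneg hs]; exact mul_le_mul_of_nonneg_left (hle g x) hs
  have hu2 : (s * τ g x) ^ 2 ≤ (s * M g) ^ 2 := by
    rw [← sq_abs]; exact pow_le_pow_left₀ (abs_nonneg _) hu 2
  calc 4 * (s * τ g x) ^ 2 * min 1 |s * τ g x| ≤ 4 * (s * M g) ^ 2 * min 1 (s * M g) := by
        gcongr
    _ = _ := by ring

lemma exp_neg_lip {x y : ℝ} (hy : 0 ≤ y) (hxy : y ≤ x) :
    |Real.exp (-y) - Real.exp (-x)| ≤ x - y := by
  have h1 : Real.exp (-x) ≤ Real.exp (-y) := Real.exp_le_exp.2 (by linarith)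
  rw [abs_of_nonneg (by linarith)]
  have h2 : Real.exp (-x) = Real.exp (-y) * Real.exp (-(x - y)) := by
    rw [← Real.exp_add]; congr 1; ring
  have h3 := Real.add_one_le_exp (-(x - y))
  have h4 : Real.exp (-y) ≤ 1 := Real.exp_le_one_iff.2 (by linarith)
  have h5 := Real.exp_pos (-y)
  rw [h2]
  nlinarith

lemma lindeberg_tendsto (ν : Measure G) [IsProbabilityMeasure ν] (M : G → ℝ) (hMm : Measurable M)
    (hM0 : ∀ g, 0 ≤ M g) (hM : MemLp M 2 ν) :
    Tendsto (fun n : ℕ => ∫ g, 4 * M g ^ 2 * min 1 ((Real.sqrt n)⁻¹ * M g) ∂ν) atTop (𝓝 0) := by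
  have hs : Tendsto (fun n : ℕ => (Real.sqrt n)⁻¹) atTop (𝓝 0) :=
    tendsto_inv_atTop_zero.comp (Real.tendsto_sqrt_atTop.comp tendsto_natCast_atTop_atTop)
  have : (0 : ℝ) = ∫ g, (0 : ℝ) ∂ν := by simp
  rw [this]
  refine tendsto_integral_of_dominated_convergence (fun g => 4 * M g ^ 2)
    (fun n => Measurable.aestronglyMeasurable (by fun_prop)) (hM.integrable_sq.const_mul 4) ?_ ?_
  · intro n
    refine Eventually.of_forall fun g => ?_
    have : 0 ≤ min 1 ((Real.sqrt n)⁻¹ * M g) :=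
      le_min zero_le_one (mul_nonneg (by positivity) (hM0 g))
    rw [Real.norm_eq_abs, abs_of_nonneg (by positivity)]
    exact mul_le_of_le_one_right (by positivity) (min_le_left _ _)
  · refine Eventually.of_forall fun g => ?_
    have h1 : Tendsto (fun n : ℕ => (Real.sqrt n)⁻¹ * M g) atTop (𝓝 0) := by
      simpa using hs.mul_const (M g)
    have h2 := (tendsto_const_nhds (x := (1 : ℝ)) (f := atTop (α := ℕ))).min h1
    simpa using h2.const_mul (4 * M g ^ 2)

lemma clt_real (hact : Measurable fun p : G × X => p.1 • p.2)
    (μ : Measure G) [IsProbabilityMeasure μ] (τ : G → X → ℝ)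
    (hτ : Measurable fun p : G × X => τ p.1 p.2)
    (hcoc : ∀ g₁ g₂ : G, ∀ x : X, τ (g₂ * g₁) x = τ g₂ (g₁ • x) + τ g₁ x)
    (M : G → ℝ) (hM : Measurable M)
    (hM0 : ∀ g, 0 ≤ M g) (hsub : ∀ g h, M (g * h) ≤ M g + M h) (h2 : MemLp M 2 μ)
    (hle : ∀ g x, |τ g x| ≤ M g) (hdrift : ∀ x, ∫ g, τ g x ∂μ = 0)
    (Q : ℝ) (hQ0 : 0 ≤ Q)
    (hQ : ∀ ε > (0 : ℝ), ∃ n₀ : ℕ, ∀ n ≥ n₀, ∀ x : X,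
      |(n : ℝ)⁻¹ * (∫ g, τ g x ^ 2 ∂convPow μ n) - Q| < ε) (ε : ℝ) (hε : 0 < ε) :
    ∃ n₀ : ℕ, ∀ n ≥ n₀, ∀ x : X,
      ‖phiC μ τ (Real.sqrt n)⁻¹ n x - ((Real.exp (-(Q / 2)) : ℝ) : ℂ)‖ < ε := by
  have hLp := memLp_convPow μ M hM hM0 hsub h2
  obtain ⟨m₀, hm₀⟩ := hQ ε hε
  obtain ⟨m, hm1, hmm⟩ : ∃ m : ℕ, 1 ≤ m ∧ m₀ ≤ m := ⟨max 1 m₀, le_max_left _ _, le_max_right _ _⟩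
  have hmQ := hm₀ m hmm
  have hmpos : (0 : ℝ) < m := by exact_mod_cast hm1
  set C : ℝ := ∑ r ∈ Finset.range m, ∫ g, M g ∂(convPow μ r) with hC
  set Ln : ℕ → ℝ := fun n => ∫ g, 4 * M g ^ 2 * min 1 ((Real.sqrt n)⁻¹ * M g) ∂(convPow μ m)
    with hLn
  have hs : Tendsto (fun n : ℕ => (Real.sqrt n)⁻¹) atTop (𝓝 0) :=
    tendsto_inv_atTop_zero.comp (Real.tendsto_sqrt_atTop.comp tendsto_natCast_atTop_atTop)
  have hn : Tendsto (fun n : ℕ => (n : ℝ)⁻¹) atTop (𝓝 0) :=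
    tendsto_inv_atTop_zero.comp tendsto_natCast_atTop_atTop
  have hE : Tendsto (fun n : ℕ => Ln n / m + m * Q ^ 2 / 4 * (n : ℝ)⁻¹ + (Real.sqrt n)⁻¹ * C
      + m * Q / 2 * (n : ℝ)⁻¹) atTop (𝓝 0) := by
    have h := (((lindeberg_tendsto (convPow μ m) M hM hM0 (hLp m)).div_const (m : ℝ)).add
      (hn.const_mul (m * Q ^ 2 / 4))).add (hs.mul_const C) |>.add (hn.const_mul (m * Q / 2))
    simpa using h
  have hn' : Tendsto (fun n : ℕ => m * Q / 2 * (n : ℝ)⁻¹) atTop (𝓝 0) := by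
    simpa using hn.const_mul (m * Q / 2)
  obtain ⟨n₀, hn₀⟩ := eventually_atTop.1 ((hE.eventually_lt_const (half_pos hε)).and
    ((hn'.eventually_lt_const zero_lt_one).and (eventually_ge_atTop 1)))
  refine ⟨n₀, fun n hnn x => ?_⟩
  obtain ⟨hE1, hq1, hn1⟩ := hn₀ n hnn
  have hnpos : (0 : ℝ) < n := by exact_mod_cast hn1
  set s : ℝ := (Real.sqrt n)⁻¹ with hsdef
  have hs0 : 0 ≤ s := by positivity
  have hs2 : s ^ 2 = (n : ℝ)⁻¹ := by
    rw [hsdef, inv_pow, Real.sq_sqrt hnpos.le]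
  set q : ℝ := m * Q / 2 * (n : ℝ)⁻¹ with hq
  have hq0 : 0 ≤ q := by positivity
  set δ : ℝ := (n : ℝ)⁻¹ * Ln n + (n : ℝ)⁻¹ / 2 * (m * ε) + q ^ 2 with hδ
  have hL0 : 0 ≤ Ln n := by
    refine integral_nonneg fun g => ?_
    have : 0 ≤ min 1 ((Real.sqrt n)⁻¹ * M g) :=
      le_min zero_le_one (mul_nonneg (by positivity) (hM0 g))
    positivity
  have hblock : ∀ x, ‖phiC μ τ s m x - ((Real.exp (-q) : ℝ) : ℂ)‖ ≤ δ := by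
    intro x
    have b1 := phiC_block μ τ hτ M hM hM0 s hs0 m (hLp m) hle x
      (drift_convPow hact μ τ hτ hcoc M hM hM0 hsub h2 hle hdrift m x)
    rw [hs2] at b1
    have b2 : |(∫ g, τ g x ^ 2 ∂convPow μ m) - m * Q| ≤ m * ε := by
      have := (hmQ x).le
      have e : (∫ g, τ g x ^ 2 ∂convPow μ m) - m * Q
        = m * ((m : ℝ)⁻¹ * (∫ g, τ g x ^ 2 ∂convPow μ m) - Q) := by
        field_simp
      rw [e, abs_mul, abs_of_pos hmpos]
      exact mul_le_mul_of_nonneg_left this hmpos.le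
    have b3 : |Real.exp (-q) - 1 - (-q)| ≤ q ^ 2 := by
      have := Real.norm_exp_sub_one_sub_id_le (x := -q) (by
        rw [norm_neg, Real.norm_eq_abs, abs_of_nonneg hq0]; exact hq1.le)
      simpa using this
    have b4 : ‖((1 - (n : ℝ)⁻¹ / 2 * ∫ g, τ g x ^ 2 ∂(convPow μ m) : ℝ) : ℂ)
        - ((Real.exp (-q) : ℝ) : ℂ)‖ ≤ (n : ℝ)⁻¹ / 2 * (m * ε) + q ^ 2 := by
      rw [← Complex.ofReal_sub, Complex.norm_real, Real.norm_eq_abs]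
      have e : (1 - (n : ℝ)⁻¹ / 2 * ∫ g, τ g x ^ 2 ∂(convPow μ m)) - Real.exp (-q)
        = -((n : ℝ)⁻¹ / 2 * ((∫ g, τ g x ^ 2 ∂convPow μ m) - m * Q))
          - (Real.exp (-q) - 1 - (-q)) := by rw [hq]; ring
      rw [e]
      refine (abs_sub _ _).trans (add_le_add ?_ b3)
      rw [abs_neg, abs_mul, abs_of_nonneg (by positivity)]
      gcongr
    have := norm_sub_le_norm_sub_add_norm_sub (phiC μ τ s m x)
      ((1 - (n : ℝ)⁻¹ / 2 * ∫ g, τ g x ^ 2 ∂(convPow μ m) : ℝ) : ℂ) ((Real.exp (-q) : ℝ) : ℂ)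
    rw [hδ]
    linarith
  have hrem : ∀ x, ‖phiC μ τ s (n % m) x - 1‖ ≤ s * C := by
    intro x
    refine (phiC_sub_one μ τ hτ M s hs0 (n % m) ((hLp _).integrable (by norm_num)) hle x).trans ?_
    refine mul_le_mul_of_nonneg_left ?_ hs0
    exact Finset.single_le_sum (f := fun r => ∫ g, M g ∂(convPow μ r))
      (fun r _ => integral_nonneg hM0) (Finset.mem_range.2 (Nat.mod_lt _ hm1))
  have ha : ‖((Real.exp (-q) : ℝ) : ℂ)‖ ≤ 1 := by
    rw [Complex.norm_real, Real.norm_eq_abs, abs_of_pos (Real.exp_pos _)]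
    exact Real.exp_le_one_iff.2 (by linarith)
  have hit := phiC_iterate hact μ τ hτ hcoc s m (n % m) _ ha δ (s * C) hblock hrem (n / m) x
  rw [Nat.div_add_mod'] at hit
  set k := n / m with hk
  have hkm : (k : ℝ) * m ≤ n := by exact_mod_cast Nat.div_mul_le_self n m
  have hkm2 : (n : ℝ) ≤ k * m + m := by
    have h1 := Nat.div_add_mod' n m
    have h2 := Nat.mod_lt n hm1
    rw [← hk] at h1
    have : n ≤ k * m + m := by omega
    exact_mod_cast this
  have hδ0 : 0 ≤ δ := by positivity
  have hkδ : k * δ ≤ Ln n / m + ε / 2 + m * Q ^ 2 / 4 * (n : ℝ)⁻¹ := by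
    have h1 : (k : ℝ) ≤ n / m := by rw [le_div_iff₀ hmpos]; exact hkm
    refine (mul_le_mul_of_nonneg_right h1 hδ0).trans (le_of_eq ?_)
    rw [hδ, hq]
    field_simp
    ring
  have hlast : ‖((Real.exp (-q) : ℝ) : ℂ) ^ k - ((Real.exp (-(Q / 2)) : ℝ) : ℂ)‖ ≤ q := by
    rw [← Complex.ofReal_pow, ← Complex.ofReal_sub, Complex.norm_real, Real.norm_eq_abs,
      ← Real.exp_nat_mul, mul_neg]
    have e : (k : ℝ) * q = (k * m) * (n : ℝ)⁻¹ * (Q / 2) := by rw [hq]; ring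
    have h3 : (k : ℝ) * m * (n : ℝ)⁻¹ ≤ 1 := by
      rw [← div_eq_mul_inv, div_le_one hnpos]; exact hkm
    refine (exp_neg_lip (by positivity) ?_).trans ?_
    · rw [e]
      exact mul_le_of_le_one_left (by positivity) h3
    · have h4 : Q / 2 = n * (n : ℝ)⁻¹ * (Q / 2) := by
        rw [mul_inv_cancel₀ hnpos.ne', one_mul]
      have h5 : (n : ℝ) * ((n : ℝ)⁻¹ * (Q / 2)) ≤ (k * m + m) * ((n : ℝ)⁻¹ * (Q / 2)) :=
        mul_le_mul_of_nonneg_right hkm2 (by positivity)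
      rw [e, hq]
      linarith
  have := norm_sub_le_norm_sub_add_norm_sub (phiC μ τ s n x)
    (((Real.exp (-q) : ℝ) : ℂ) ^ k) ((Real.exp (-(Q / 2)) : ℝ) : ℂ)
  linarith

end Helpers

/-- uniform central limit theorem, with limit the Gaussian of covariance `A`. -/
theorem clt_uniform
    {G : Type*} [Group G] [MeasurableSpace G] [MeasurableMul₂ G]
    {X : Type*} [MetricSpace X] [CompactSpace X] [MeasurableSpace X] [BorelSpace X]
    [MulAction G X] (hact : Measurable fun p : G × X => p.1 • p.2)
    {d : ℕ} (σ : G → X → EuclideanSpace ℝ (Fin d))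
    (hσmeas : Measurable fun p : G × X => σ p.1 p.2)
    (hcoc : ∀ g₁ g₂ : G, ∀ x : X, σ (g₂ * g₁) x = σ g₂ (g₁ • x) + σ g₁ x)
    (N : G → ℝ) (hN0 : ∀ g, 0 ≤ N g) (hNsub : ∀ g h : G, N (g * h) ≤ N g + N h)
    (hNσ : ∀ g x, ‖σ g x‖ ≤ N g)
    (μ : Measure G) [IsProbabilityMeasure μ]
    (hmom1 : Integrable N μ)
    (hdrift : ∀ x, ∫ g, σ g x ∂μ = 0)
    (hmom2 : Integrable (fun g => N g ^ 2) μ)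
    (hcont : ∀ g, Continuous (σ g))
    (hXctrl : ∀ ε > (0 : ℝ), ∃ R > (0 : ℝ), ∀ n : ℕ, 1 ≤ n → ∀ x y : X,
      ENNReal.ofReal (1 - ε) ≤ convPow μ n {g | ‖σ g x - σ g y‖ ≤ R})
    (A : Matrix (Fin d) (Fin d) ℝ) (hApsd : A.PosSemidef)
    (hA : ∀ ε > (0 : ℝ), ∃ n₀ : ℕ, ∀ n ≥ n₀, ∀ x : X, ∀ i j : Fin d,
      |(n : ℝ)⁻¹ * (∫ g, σ g x i * σ g x j ∂convPow μ n) - A i j| < ε) :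
    ∃ γ : Measure (EuclideanSpace ℝ (Fin d)), IsProbabilityMeasure γ ∧
      (∀ t : EuclideanSpace ℝ (Fin d),
        ∫ v, Complex.exp (Complex.I * ((∑ i, t i * v i : ℝ) : ℂ)) ∂γ
          = Complex.exp (-(((∑ i, ∑ j, t i * A i j * t j : ℝ) : ℂ)) / 2)) ∧
      ∀ f : BoundedContinuousFunction (EuclideanSpace ℝ (Fin d)) ℝ, ∀ ε > (0 : ℝ),
        ∃ n₀ : ℕ, ∀ n ≥ n₀, ∀ x : X,
          |(∫ g, f ((Real.sqrt n)⁻¹ • σ g x) ∂convPow μ n) - ∫ v, f v ∂γ| < ε := by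
  classical
  set Q : EuclideanSpace ℝ (Fin d) → ℝ := fun t => ∑ i, ∑ j, t i * A i j * t j with hQdef
  have hdot : ∀ t : EuclideanSpace ℝ (Fin d), t.ofLp ⬝ᵥ A.mulVec t.ofLp = Q t := by
    intro t
    simp only [hQdef, dotProduct, Matrix.mulVec, Finset.mul_sum, mul_assoc]
  have hQ0 : ∀ t, 0 ≤ Q t := by
    intro t
    rw [← hdot]
    simpa using hApsd.dotProduct_mulVec_nonneg t.ofLp
  have hinner : ∀ v t : EuclideanSpace ℝ (Fin d), inner ℝ v t = ∑ i, t i * v i := by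
    intro v t
    simp [PiLp.inner_apply]
  have hchar : ∀ t, charFun (ProbabilityTheory.multivariateGaussian 0 A) t
      = ((Real.exp (-(Q t / 2)) : ℝ) : ℂ) := by
    intro t
    rw [ProbabilityTheory.charFun_multivariateGaussian hApsd, hdot]
    simp
  refine ⟨ProbabilityTheory.multivariateGaussian 0 A, inferInstance, ?_, ?_⟩
  · intro t
    have h := hchar t
    rw [charFun_apply] at h
    simp only [hinner] at h
    rw [show (fun v : EuclideanSpace ℝ (Fin d) =>
        Complex.exp (Complex.I * ((∑ i, t i * v i : ℝ) : ℂ)))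
      = fun v => Complex.exp (((∑ i, t i * v i : ℝ) : ℂ) * Complex.I) from
        funext fun v => by rw [mul_comm], h, Complex.ofReal_exp]
    congr 1
    push_cast [hQdef]
    ring
  have key : ∀ t : EuclideanSpace ℝ (Fin d), ∀ ε > (0 : ℝ), ∃ n₀ : ℕ, ∀ n ≥ n₀, ∀ x : X,
      ‖phiC μ (fun g x => inner ℝ (σ g x) t) (Real.sqrt n)⁻¹ n x
        - ((Real.exp (-(Q t / 2)) : ℝ) : ℂ)‖ < ε := by
    intro t
    rcases isEmpty_or_nonempty X with hX | hX
    · exact fun ε _ => ⟨0, fun n _ x => hX.elim x⟩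
    set M : G → ℝ := fun g => ⨆ k, ‖σ g (TopologicalSpace.denseSeq X k)‖ with hM
    have hbdd : ∀ g, BddAbove (Set.range fun k => ‖σ g (TopologicalSpace.denseSeq X k)‖) :=
      fun g => ⟨N g, by rintro _ ⟨k, rfl⟩; exact hNσ g _⟩
    have hMle : ∀ g x, ‖σ g x‖ ≤ M g := by
      intro g x
      have hcl : IsClosed {x : X | ‖σ g x‖ ≤ M g} :=
        isClosed_le (hcont g).norm continuous_const
      have hsub : Set.range (TopologicalSpace.denseSeq X) ⊆ {x : X | ‖σ g x‖ ≤ M g} := by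
        rintro _ ⟨k, rfl⟩
        exact le_ciSup (hbdd g) k
      have := hcl.closure_subset_iff.2 hsub
      rw [(TopologicalSpace.denseRange_denseSeq X).closure_range] at this
      exact this (Set.mem_univ x)
    have hMN : ∀ g, M g ≤ N g := fun g => ciSup_le fun k => hNσ g _
    have hM0 : ∀ g, 0 ≤ M g := fun g => (norm_nonneg _).trans (hMle g (Classical.arbitrary X))
    have hMmeas : Measurable M := Measurable.iSup fun k => (meas_sec hσmeas _).norm
    have hMsub : ∀ g h, M (g * h) ≤ M g + M h := by
      intro g h
      refine ciSup_le fun k => ?_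
      rw [hcoc]
      exact (norm_add_le _ _).trans (add_le_add (hMle _ _) (hMle _ _))
    have hMLp : MemLp M 2 μ := by
      refine ((memLp_two_iff_integrable_sq hmom1.aestronglyMeasurable).2 hmom2).mono
        hMmeas.aestronglyMeasurable (Eventually.of_forall fun g => ?_)
      rw [Real.norm_eq_abs, Real.norm_eq_abs, abs_of_nonneg (hM0 g), abs_of_nonneg (hN0 g)]
      exact hMN g
    have hσi : ∀ x, Integrable (fun g => σ g x) μ := fun x =>
      hmom1.mono' (meas_sec hσmeas x).aestronglyMeasurable (Eventually.of_forall fun g => hNσ g x)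
    refine clt_real hact μ (fun g x => inner ℝ (σ g x) t) (hσmeas.inner measurable_const) ?_
      (fun g => M g * ‖t‖) (hMmeas.mul_const _) (fun g => mul_nonneg (hM0 g) (norm_nonneg _)) ?_
      (hMLp.mul_const _) ?_ ?_ (Q t) (hQ0 t) ?_
    · intro g₁ g₂ x
      simp only [hcoc, inner_add_left]
    · intro g h
      rw [← add_mul]
      exact mul_le_mul_of_nonneg_right (hMsub g h) (norm_nonneg _)
    · intro g x
      exact (abs_real_inner_le_norm _ _).trans
        (mul_le_mul_of_nonneg_right (hMle g x) (norm_nonneg _))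
    · intro x
      simp only [real_inner_comm t]
      rw [integral_inner (hσi x), hdrift, inner_zero_right]
    · intro ε hε
      set B : ℝ := ∑ i, ∑ j, |t i| * |t j| with hB
      have hB0 : 0 ≤ B := Finset.sum_nonneg fun i _ => Finset.sum_nonneg fun j _ => by positivity
      obtain ⟨n₀, hn₀⟩ := hA (ε / (B + 1)) (by positivity)
      refine ⟨n₀, fun n hn x => ?_⟩
      have hLp : MemLp M 2 (convPow μ n) := memLp_convPow μ M hMmeas hM0 hMsub hMLp n
      have hco : ∀ i, MemLp (fun g => σ g x i) 2 (convPow μ n) := fun i => by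
        refine hLp.mono (Measurable.aestronglyMeasurable ?_) (Eventually.of_forall fun g => ?_)
        · have := meas_sec hσmeas x
          fun_prop
        · rw [Real.norm_eq_abs (M g), abs_of_nonneg (hM0 g)]
          exact (PiLp.norm_apply_le _ i).trans (hMle g x)
      have hij : ∀ i j, Integrable (fun g => σ g x i * σ g x j) (convPow μ n) :=
        fun i j => (hco i).integrable_mul (hco j)
      have e1 : ∫ g, (inner ℝ (σ g x) t) ^ 2 ∂convPow μ n
          = ∑ i, ∑ j, t i * t j * ∫ g, σ g x i * σ g x j ∂convPow μ n := by
        have : ∀ g, (inner ℝ (σ g x) t) ^ 2 = ∑ i, ∑ j, t i * t j * (σ g x i * σ g x j) := by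
          intro g
          rw [hinner, sq, Finset.sum_mul_sum]
          exact Finset.sum_congr rfl fun i _ => Finset.sum_congr rfl fun j _ => by ring
        simp_rw [this]
        rw [integral_finsetSum _ fun i _ => integrable_finsetSum _ fun j _ => (hij i j).const_mul _]
        refine Finset.sum_congr rfl fun i _ => ?_
        rw [integral_finsetSum _ fun j _ => (hij i j).const_mul _]
        exact Finset.sum_congr rfl fun j _ => integral_const_mul _ _
      have e2 : (n : ℝ)⁻¹ * (∫ g, (inner ℝ (σ g x) t) ^ 2 ∂convPow μ n) - Q t
          = ∑ i, ∑ j, t i * t j *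
            ((n : ℝ)⁻¹ * (∫ g, σ g x i * σ g x j ∂convPow μ n) - A i j) := by
        rw [e1, hQdef, Finset.mul_sum, ← Finset.sum_sub_distrib]
        refine Finset.sum_congr rfl fun i _ => ?_
        rw [Finset.mul_sum, ← Finset.sum_sub_distrib]
        exact Finset.sum_congr rfl fun j _ => by ring
      rw [e2]
      have e3 : |∑ i, ∑ j, t i * t j *
            ((n : ℝ)⁻¹ * (∫ g, σ g x i * σ g x j ∂convPow μ n) - A i j)| ≤ B * (ε / (B + 1)) := by
        rw [hB, Finset.sum_mul]
        refine (Finset.abs_sum_le_sum_abs _ _).trans (Finset.sum_le_sum fun i _ => ?_)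
        rw [Finset.sum_mul]
        refine (Finset.abs_sum_le_sum_abs _ _).trans (Finset.sum_le_sum fun j _ => ?_)
        rw [abs_mul, abs_mul]
        exact mul_le_mul_of_nonneg_left (hn₀ n hn x i j).le (by positivity)
      refine e3.trans_lt ?_
      rw [← mul_div_assoc, div_lt_iff₀ (by positivity)]
      nlinarith
  intro f ε hε
  by_contra hcon
  push Not at hcon
  choose n hn x hx using hcon
  have hmeas : ∀ k, Measurable fun g => (Real.sqrt (n k))⁻¹ • σ g (x k) := fun k => by
    have := meas_sec hσmeas (x k)
    fun_prop
  set ν : ℕ → ProbabilityMeasure (EuclideanSpace ℝ (Fin d)) := fun k =>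
    ⟨(convPow μ (n k)).map fun g => (Real.sqrt (n k))⁻¹ • σ g (x k),
      Measure.isProbabilityMeasure_map (hmeas k).aemeasurable⟩ with hν
  set γ : ProbabilityMeasure (EuclideanSpace ℝ (Fin d)) :=
    ⟨ProbabilityTheory.multivariateGaussian 0 A, inferInstance⟩ with hγ
  have hconv : Tendsto ν atTop (𝓝 γ) := by
    refine ProbabilityMeasure.tendsto_of_tendsto_charFun fun t => ?_
    change Tendsto _ _ (𝓝 (charFun (ProbabilityTheory.multivariateGaussian 0 A) t))
    rw [hchar, Metric.tendsto_atTop]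
    intro δ hδ
    obtain ⟨k₀, hk₀⟩ := key t δ hδ
    refine ⟨k₀, fun k hk => ?_⟩
    have h := hk₀ (n k) (hk.le.trans (hn k)) (x k)
    rw [dist_eq_norm]
    suffices hs : charFun ((convPow μ (n k)).map fun g => (Real.sqrt (n k))⁻¹ • σ g (x k)) t
        = phiC μ (fun g x => inner ℝ (σ g x) t) (Real.sqrt (n k))⁻¹ (n k) (x k) by
      rw [← hs] at h
      exact h
    rw [charFun_apply, integral_map (hmeas k).aemeasurable
      (Measurable.aestronglyMeasurable (by fun_prop)), phiC]
    refine integral_congr_ae (Eventually.of_forall fun g => ?_)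
    simp only [real_inner_smul_left]
    rw [mul_comm]
  rw [ProbabilityMeasure.tendsto_iff_forall_integral_tendsto] at hconv
  have h := hconv f
  rw [Metric.tendsto_atTop] at h
  obtain ⟨k, hk⟩ := h ε hε
  have hk := hk k le_rfl
  rw [Real.dist_eq] at hk
  have e : ∫ v, f v ∂(ν k : Measure (EuclideanSpace ℝ (Fin d)))
      = ∫ g, f ((Real.sqrt (n k))⁻¹ • σ g (x k)) ∂convPow μ (n k) :=
    integral_map (hmeas k).aemeasurable f.continuous.measurable.aestronglyMeasurable
  rw [e] at hk
  exact absurd hk (not_lt.2 (hx k))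
end
end

section
/- Assume d = 1, μ has finite exponential moment, σ is X-controlled, and the limit variance A > 0, where A is the number such that (1/n) ∫_G σ(g,x)² dμ^{*n}(g) → A uniformly in x. Fix k, l > 0 and families (k_s)_{s>0}, (l_s)_{s>0} of reals with k_s ∼ sk and l_s ∼ sl as s → ∞. Then for every x ∈ X, β{b ∈ B : there exists n ≥ 1 with σ(b_n⋯b_1, x) ≥ l_s and σ(b_m⋯b_1, x) > −k_s for every 1 ≤ m < n} converges to k/(k+l) as s → ∞. -/
open MeasureTheory Filter Topology
open scoped ENNReal NNReal

noncomputable section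

/-- The exit time `τ_s(b, x) = inf {n ≥ 1 : σ(b_n ⋯ b_1, x) ≥ s}`. -/
def exitTime {G : Type*} [Monoid G] {X : Type*} (σ : G → X → ℝ) (s : ℝ)
    (b : ℕ → G) (x : X) : ℕ :=
  sInf {n : ℕ | 1 ≤ n ∧ s ≤ σ (prodRev b n) x}

set_option linter.unusedSectionVars false

section GR

variable {G : Type*} [Group G] [MeasurableSpace G] [MeasurableMul₂ G]
  {X : Type*} [MetricSpace X] [CompactSpace X] [MeasurableSpace X] [BorelSpace X] [MulAction G X]

/-- One step of the stopped chain. -/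
def grStep (σ : G → X → ℝ) (a l : ℝ) (g : G) (s : X × ℝ) : X × ℝ :=
  open Classical in if s.2 ∈ Set.Ioo (-a) l then (g • s.1, s.2 + σ g s.1) else s

/-- Law of the stopped chain. -/
def grLaw (σ : G → X → ℝ) (a l : ℝ) (μ : Measure G) (x : X) : ℕ → Measure (X × ℝ)
  | 0 => Measure.dirac (x, 0)
  | n + 1 => (μ.prod (grLaw σ a l μ x n)).map fun p => grStep σ a l p.1 p.2

/-- The stopped chain along a path. -/
def grPath (σ : G → X → ℝ) (a l : ℝ) (x : X) (b : ℕ → G) : ℕ → X × ℝ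
  | 0 => (x, 0)
  | n + 1 => grStep σ a l (b n) (grPath σ a l x b n)

/-- The stopped chain, as a function of finitely many coordinates. -/
def grFin (σ : G → X → ℝ) (a l : ℝ) (x : X) : (n : ℕ) → (Fin n → G) → X × ℝ
  | 0, _ => (x, 0)
  | n + 1, f => grStep σ a l (f (Fin.last n)) (grFin σ a l x n (fun i => f i.castSucc))

lemma grPath_eq_grFin (σ : G → X → ℝ) (a l : ℝ) (x : X) (b : ℕ → G) (n : ℕ) :
    grPath σ a l x b n = grFin σ a l x n (fun i => b i) := by
  induction n with
  | zero => rfl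
  | succ n ih => simp only [grPath, grFin, ih]; rfl

lemma measurable_grStep {σ : G → X → ℝ} (hact : Measurable fun p : G × X => p.1 • p.2)
    (hσmeas : Measurable fun p : G × X => σ p.1 p.2) (a l : ℝ) :
    Measurable fun p : G × (X × ℝ) => grStep σ a l p.1 p.2 := by
  unfold grStep
  refine Measurable.ite ?_ ?_ measurable_snd
  · exact (measurable_snd.comp measurable_snd) measurableSet_Ioo
  · have h1 : Measurable fun p : G × (X × ℝ) => (p.1, p.2.1) := by fun_prop
    exact (hact.comp h1).prodMk ((measurable_snd.comp measurable_snd).add (hσmeas.comp h1))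

lemma measurable_grFin {σ : G → X → ℝ} (hact : Measurable fun p : G × X => p.1 • p.2)
    (hσmeas : Measurable fun p : G × X => σ p.1 p.2) (a l : ℝ) (x : X) (n : ℕ) :
    Measurable (grFin σ a l x n) := by
  induction n with
  | zero => exact measurable_const
  | succ n ih =>
    have h1 : Measurable fun f : Fin (n + 1) → G => 
        (f (Fin.last n), grFin σ a l x n (fun i => f i.castSucc)) :=
      (measurable_pi_apply _).prodMk (ih.comp (by fun_prop))
    exact (measurable_grStep hact hσmeas a l).comp h1

lemma isProb_grLaw {σ : G → X → ℝ} (hact : Measurable fun p : G × X => p.1 • p.2)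
    (hσmeas : Measurable fun p : G × X => σ p.1 p.2) (a l : ℝ)
    (μ : Measure G) [IsProbabilityMeasure μ] (x : X) (n : ℕ) :
    IsProbabilityMeasure (grLaw σ a l μ x n) := by
  induction n with
  | zero => unfold grLaw; infer_instance
  | succ n ih =>
    unfold grLaw
    exact Measure.isProbabilityMeasure_map (measurable_grStep hact hσmeas a l).aemeasurable

lemma map_grFin {σ : G → X → ℝ} (hact : Measurable fun p : G × X => p.1 • p.2)
    (hσmeas : Measurable fun p : G × X => σ p.1 p.2) (a l : ℝ)
    (μ : Measure G) [IsProbabilityMeasure μ] (x : X) (n : ℕ) :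
    (Measure.pi fun _ : Fin n => μ).map (grFin σ a l x n) = grLaw σ a l μ x n := by
  induction n with
  | zero =>
    have : grFin σ a l x 0 = fun _ => (x, (0:ℝ)) := rfl
    rw [this, Measure.map_const]; simp [grLaw]
  | succ n ih =>
    have hmp := (measurePreserving_piFinSuccAbove (fun _ : Fin (n+1) => μ) (Fin.last n))
    have h2 : grFin σ a l x (n+1) =
        (fun p : G × (X × ℝ) => grStep σ a l p.1 p.2) ∘ (Prod.map id (grFin σ a l x n)) ∘
        (MeasurableEquiv.piFinSuccAbove (fun _ : Fin (n+1) => G) (Fin.last n)) := by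
      funext f
      simp [grFin, MeasurableEquiv.piFinSuccAbove]
      rfl
    have hF := measurable_grFin hact hσmeas a l x n
    rw [h2, ← Measure.map_map (measurable_grStep hact hσmeas a l)
      ((measurable_id.prodMap hF).comp (MeasurableEquiv.measurable _)),
      ← Measure.map_map (measurable_id.prodMap hF) (MeasurableEquiv.measurable _), hmp.map_eq]
    simp only [grLaw]
    rw [← ih, ← Measure.map_prod_map _ _ measurable_id hF, Measure.map_id]

lemma integrable_sq_grLaw {σ : G → X → ℝ} (hact : Measurable fun p : G × X => p.1 • p.2)
    (hσmeas : Measurable fun p : G × X => σ p.1 p.2) (a l : ℝ)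
    (μ : Measure G) [IsProbabilityMeasure μ] (N : G → ℝ)
    (hNσ : ∀ g x, |σ g x| ≤ N g) (hN2 : Integrable (fun g => N g ^ 2) μ) (x : X) (n : ℕ) :
    Integrable (fun s : X × ℝ => s.2 ^ 2) (grLaw σ a l μ x n) := by
  induction n with
  | zero => unfold grLaw; exact integrable_dirac (by simp)
  | succ n ih =>
    have := isProb_grLaw hact hσmeas a l μ x n
    have hm := measurable_grStep hact hσmeas a l
    unfold grLaw
    have hsq : Measurable (fun s : X × ℝ => s.2 ^ 2) := by fun_prop
    rw [integrable_map_measure hsq.aestronglyMeasurable hm.aemeasurable]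
    refine Integrable.mono' (((hN2.const_mul 2).comp_fst (grLaw σ a l μ x n)).add
      ((ih.const_mul 2).comp_snd μ)) (hsq.comp hm).aestronglyMeasurable (ae_of_all _ ?_)
    rintro ⟨g, y, t⟩
    have h1 : σ g y ^ 2 ≤ N g ^ 2 := sq_le_sq' (by linarith [neg_abs_le (σ g y), hNσ g y]) ((le_abs_self _).trans (hNσ g y))
    simp only [Function.comp, grStep, Pi.add_apply, Real.norm_eq_abs, abs_sq]
    split_ifs
    · simp only; nlinarith [sq_nonneg (t - σ g y)]
    · simp only; nlinarith [sq_nonneg (N g), sq_nonneg t]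

lemma integrable_grLaw {σ : G → X → ℝ} (hact : Measurable fun p : G × X => p.1 • p.2)
    (hσmeas : Measurable fun p : G × X => σ p.1 p.2) (a l : ℝ)
    (μ : Measure G) [IsProbabilityMeasure μ] (N : G → ℝ)
    (hNσ : ∀ g x, |σ g x| ≤ N g) (hN2 : Integrable (fun g => N g ^ 2) μ) (x : X) (n : ℕ)
    (F : X × ℝ → ℝ) (hF : Measurable F) (K : ℝ) (hFK : ∀ s, |F s| ≤ K * (1 + s.2 ^ 2)) :
    Integrable F (grLaw σ a l μ x n) := by
  have := isProb_grLaw hact hσmeas a l μ x n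
  exact Integrable.mono' (((integrable_const (1:ℝ)).add
    (integrable_sq_grLaw hact hσmeas a l μ N hNσ hN2 x n)).const_mul K)
    hF.aestronglyMeasurable (ae_of_all _ hFK)

lemma drift_grLaw {σ : G → X → ℝ} (hact : Measurable fun p : G × X => p.1 • p.2)
    (hσmeas : Measurable fun p : G × X => σ p.1 p.2) (a l : ℝ)
    (μ : Measure G) [IsProbabilityMeasure μ] (N : G → ℝ)
    (hNσ : ∀ g x, |σ g x| ≤ N g) (hN2 : Integrable (fun g => N g ^ 2) μ) (x : X) (n : ℕ)
    (F : X × ℝ → ℝ) (hF : Measurable F) (K : ℝ) (hFK : ∀ s, |F s| ≤ K * (1 + s.2 ^ 2))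
    (c : ℝ) (hc : ∀ y : X, ∀ t ∈ Set.Ioo (-a) l, 
      F (y, t) + c ≤ ∫ g, F (g • y, t + σ g y) ∂μ) :
    (∫ s, F s ∂grLaw σ a l μ x n) + c * (grLaw σ a l μ x n).real {s | s.2 ∈ Set.Ioo (-a) l}
      ≤ ∫ s, F s ∂grLaw σ a l μ x (n+1) := by
  have := isProb_grLaw hact hσmeas a l μ x n
  have hm := measurable_grStep hact hσmeas a l
  have hJ : MeasurableSet {s : X × ℝ | s.2 ∈ Set.Ioo (-a) l} := measurable_snd measurableSet_Ioo
  have hi := integrable_grLaw hact hσmeas a l μ N hNσ hN2 x n F hF K hFK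
  have hi1 := integrable_grLaw hact hσmeas a l μ N hNσ hN2 x (n+1) F hF K hFK
  have hi2 : Integrable (fun p : G × (X × ℝ) => F (grStep σ a l p.1 p.2))
      (μ.prod (grLaw σ a l μ x n)) := by
    unfold grLaw at hi1
    exact (integrable_map_measure hF.aestronglyMeasurable hm.aemeasurable).1 hi1
  have e1 : ∫ s, F s ∂grLaw σ a l μ x (n+1) =
      ∫ s, ∫ g, F (grStep σ a l g s) ∂μ ∂grLaw σ a l μ x n := by
    conv_lhs => unfold grLaw
    rw [integral_map hm.aemeasurable hF.aestronglyMeasurable, integral_prod_symm _ hi2]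
  have e2 : (∫ s, F s ∂grLaw σ a l μ x n) +
      c * (grLaw σ a l μ x n).real {s | s.2 ∈ Set.Ioo (-a) l} =
      ∫ s, F s + Set.indicator {s : X × ℝ | s.2 ∈ Set.Ioo (-a) l} (fun _ => c) s
        ∂grLaw σ a l μ x n := by
    rw [integral_add hi ((integrable_const c).indicator hJ), integral_indicator_const _ hJ,
      smul_eq_mul, mul_comm]
  rw [e1, e2]
  refine integral_mono (hi.add ((integrable_const c).indicator hJ)) hi2.integral_prod_right ?_
  rintro ⟨y, t⟩
  by_cases ht : t ∈ Set.Ioo (-a) l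
  · simp only [grStep, if_pos ht]
    rw [Set.indicator_of_mem (by exact ht)]
    exact hc y t ht
  · simp only [grStep, if_neg ht]
    rw [Set.indicator_of_notMem (by exact ht)]
    simp

end GR

section GR2

variable {G : Type*} [Group G] [MeasurableSpace G] [MeasurableMul₂ G]
  {X : Type*} [MetricSpace X] [CompactSpace X] [MeasurableSpace X] [BorelSpace X] [MulAction G X]

/-- The Markov operator. -/
def grOp (μ : Measure G) (f : X → ℝ) : X → ℝ := fun x => ∫ g, f (g • x) ∂μ

/-- Bounded measurable functions. -/
def grBM (f : X → ℝ) : Prop := Measurable f ∧ ∃ C, ∀ x, |f x| ≤ C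

lemma grBM_integrable (hact : Measurable fun p : G × X => p.1 • p.2)
    (μ : Measure G) [IsFiniteMeasure μ] {f : X → ℝ} (hf : grBM f) (x : X) :
    Integrable (fun g => f (g • x)) μ := by
  obtain ⟨hm, C, hC⟩ := hf
  have h1 : Measurable fun g : G => g • x := hact.comp (measurable_id.prodMk measurable_const)
  exact Integrable.mono' (integrable_const C) (hm.comp h1).aestronglyMeasurable
    (ae_of_all _ fun g => hC _)

lemma grBM_op (hact : Measurable fun p : G × X => p.1 • p.2)
    (μ : Measure G) [IsProbabilityMeasure μ] {f : X → ℝ} (hf : grBM f) : grBM (grOp μ f) := by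
  obtain ⟨hm, C, hC⟩ := hf
  constructor
  · have h1 : StronglyMeasurable fun p : X × G => f (p.2 • p.1) :=
      (hm.comp (hact.comp measurable_swap)).stronglyMeasurable
    exact h1.integral_prod_right.measurable
  · refine ⟨C, fun x => ?_⟩
    have := norm_integral_le_of_norm_le_const (μ := μ) (f := fun g => f (g • x)) (C := C)
      (ae_of_all _ fun g => hC _)
    simpa [grOp] using this

lemma isProb_convPow (μ : Measure G) [IsProbabilityMeasure μ] (n : ℕ) :
    IsProbabilityMeasure (convPow μ n) := by
  induction n with
  | zero => unfold convPow; infer_instance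
  | succ n ih =>
    unfold convPow
    exact Measure.isProbabilityMeasure_map measurable_mul.aemeasurable

lemma convPow_op (hact : Measurable fun p : G × X => p.1 • p.2)
    (μ : Measure G) [IsProbabilityMeasure μ] (n : ℕ) (f : X → ℝ) (hf : grBM f) (x : X) :
    ∫ g, f (g • x) ∂convPow μ n = ((grOp μ)^[n] f) x := by
  induction n generalizing f with
  | zero =>
    have h1 : Measurable fun g : G => g • x := hact.comp (measurable_id.prodMk measurable_const)
    have h2 : Measurable fun g : G => f (g • x) := hf.1.comp h1
    simp only [convPow]
    rw [integral_dirac' _ _ h2.stronglyMeasurable]; simp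
  | succ n ih =>
    have := isProb_convPow μ n
    have := isProb_convPow μ (n+1)
    have h1 : Measurable fun g : G => g • x := hact.comp (measurable_id.prodMk measurable_const)
    have hi := grBM_integrable hact (convPow μ (n+1)) hf x
    rw [Function.iterate_succ_apply, ← ih _ (grBM_op hact μ hf)]
    have h2 : Measurable fun g : G => f (g • x) := hf.1.comp h1
    conv_lhs => unfold convPow
    unfold convPow at hi
    have hi2 : Integrable (fun p : G × G => f ((p.1 * p.2) • x)) (μ.prod (convPow μ n)) :=
      (integrable_map_measure h2.aestronglyMeasurable measurable_mul.aemeasurable).1 hi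
    rw [integral_map measurable_mul.aemeasurable h2.aestronglyMeasurable,
      integral_prod_symm _ hi2]
    simp only [grOp, mul_smul]

lemma integrable_sq_convPow {σ : G → X → ℝ}
    (hσmeas : Measurable fun p : G × X => σ p.1 p.2)
    (hcoc : ∀ g₁ g₂ : G, ∀ x : X, σ (g₂ * g₁) x = σ g₂ (g₁ • x) + σ g₁ x)
    (N : G → ℝ) (hNσ : ∀ g x, |σ g x| ≤ N g)
    (μ : Measure G) [IsProbabilityMeasure μ]
    (hN2 : Integrable (fun g => N g ^ 2) μ) (x : X) (n : ℕ) :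
    Integrable (fun g => σ g x ^ 2) (convPow μ n) := by
  have hsx : Measurable fun g => σ g x ^ 2 :=
    (hσmeas.comp (measurable_id.prodMk measurable_const)).pow_const 2
  induction n with
  | zero => exact ⟨hsx.aestronglyMeasurable, by
      simp only [convPow, HasFiniteIntegral]
      rw [lintegral_dirac' _ hsx.enorm]; simp⟩
  | succ n ih =>
    have := isProb_convPow μ n
    unfold convPow
    rw [integrable_map_measure hsx.aestronglyMeasurable measurable_mul.aemeasurable]
    refine Integrable.mono' (((hN2.const_mul 2).comp_fst (convPow μ n)).add
      ((ih.const_mul 2).comp_snd μ)) (hsx.comp measurable_mul).aestronglyMeasurable (ae_of_all _ ?_)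
    rintro ⟨g, h⟩
    have h1 : σ g (h • x) ^ 2 ≤ N g ^ 2 := sq_le_sq' (by linarith [neg_abs_le (σ g (h • x)), hNσ g (h • x)]) ((le_abs_self _).trans (hNσ g (h • x)))
    simp only [Function.comp, Pi.add_apply, Real.norm_eq_abs, abs_sq, hcoc]
    nlinarith [sq_nonneg (σ g (h • x) - σ h x)]

lemma int_add_sq {σ : G → X → ℝ}
    (hσmeas : Measurable fun p : G × X => σ p.1 p.2)
    (N : G → ℝ) (hNσ : ∀ g x, |σ g x| ≤ N g)
    (μ : Measure G) [IsProbabilityMeasure μ] (hN1 : Integrable N μ)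
    (hN2 : Integrable (fun g => N g ^ 2) μ)
    (hdrift : ∀ x, ∫ g, σ g x ∂μ = 0) (y : X) (t : ℝ) :
    Integrable (fun g => σ g y) μ ∧ Integrable (fun g => (t + σ g y) ^ 2) μ ∧
    ∫ g, (t + σ g y) ^ 2 ∂μ = t ^ 2 + ∫ g, σ g y ^ 2 ∂μ := by
  have hm : Measurable fun g => σ g y := hσmeas.comp (measurable_id.prodMk measurable_const)
  have i1 : Integrable (fun g => σ g y) μ :=
    Integrable.mono' hN1 hm.aestronglyMeasurable (ae_of_all _ fun g => hNσ g y)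
  have i2 : Integrable (fun g => σ g y ^ 2) μ :=
    Integrable.mono' hN2 (hm.pow_const 2).aestronglyMeasurable (ae_of_all _ fun g => by
      rw [Real.norm_eq_abs, abs_pow]; exact pow_le_pow_left₀ (abs_nonneg _) (hNσ g y) 2)
  have e : (fun g => (t + σ g y) ^ 2) = fun g => (t ^ 2 + 2 * t * σ g y) + σ g y ^ 2 := by
    funext g; ring
  have i3 : Integrable (fun g => t ^ 2 + 2 * t * σ g y) μ :=
    (integrable_const _).add (i1.const_mul _)
  refine ⟨i1, ?_, ?_⟩
  · rw [e]; exact i3.add i2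
  · rw [e, integral_add i3 i2, integral_add (integrable_const _) (i1.const_mul _),
      integral_const_mul, hdrift]
    simp

lemma grBM_V {σ : G → X → ℝ}
    (hσmeas : Measurable fun p : G × X => σ p.1 p.2)
    (N : G → ℝ) (hNσ : ∀ g x, |σ g x| ≤ N g)
    (μ : Measure G) [IsProbabilityMeasure μ]
    (hN2 : Integrable (fun g => N g ^ 2) μ) : grBM (fun x => ∫ g, σ g x ^ 2 ∂μ) := by
  constructor
  · have h1 : StronglyMeasurable fun p : X × G => σ p.2 p.1 ^ 2 :=
      ((hσmeas.comp measurable_swap).pow_const 2).stronglyMeasurable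
    exact h1.integral_prod_right.measurable
  · refine ⟨∫ g, N g ^ 2 ∂μ, fun x => ?_⟩
    rw [abs_of_nonneg (integral_nonneg fun g => sq_nonneg _)]
    refine integral_mono_of_nonneg (ae_of_all _ fun g => sq_nonneg _) hN2 (ae_of_all _ fun g => ?_)
    simp only
    rw [← sq_abs]; exact pow_le_pow_left₀ (abs_nonneg _) (hNσ g x) 2

lemma convPow_sq {σ : G → X → ℝ} (hact : Measurable fun p : G × X => p.1 • p.2)
    (hσmeas : Measurable fun p : G × X => σ p.1 p.2)
    (hcoc : ∀ g₁ g₂ : G, ∀ x : X, σ (g₂ * g₁) x = σ g₂ (g₁ • x) + σ g₁ x)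
    (N : G → ℝ) (hNσ : ∀ g x, |σ g x| ≤ N g)
    (μ : Measure G) [IsProbabilityMeasure μ] (hN1 : Integrable N μ)
    (hN2 : Integrable (fun g => N g ^ 2) μ)
    (hdrift : ∀ x, ∫ g, σ g x ∂μ = 0) (x : X) (n : ℕ) :
    ∫ g, σ g x ^ 2 ∂convPow μ n =
      ∑ i ∈ Finset.range n, ((grOp μ)^[i] (fun x => ∫ g, σ g x ^ 2 ∂μ)) x := by
  have hsx : Measurable fun g => σ g x ^ 2 :=
    (hσmeas.comp (measurable_id.prodMk measurable_const)).pow_const 2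
  have hV := grBM_V hσmeas N hNσ μ hN2
  induction n with
  | zero =>
    simp only [convPow]
    rw [integral_dirac' _ _ hsx.stronglyMeasurable]
    have := hcoc 1 1 x
    simp at this
    simp [this]
  | succ n ih =>
    have := isProb_convPow μ n
    have hi := integrable_sq_convPow hσmeas hcoc N hNσ μ hN2 x (n+1)
    have hin := integrable_sq_convPow hσmeas hcoc N hNσ μ hN2 x n
    rw [Finset.sum_range_succ, ← ih, ← convPow_op hact μ n _ hV x]
    conv_lhs => unfold convPow
    unfold convPow at hi
    have hi2 : Integrable (fun p : G × G => σ (p.1 * p.2) x ^ 2) (μ.prod (convPow μ n)) :=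
      (integrable_map_measure hsx.aestronglyMeasurable measurable_mul.aemeasurable).1 hi
    rw [integral_map measurable_mul.aemeasurable hsx.aestronglyMeasurable,
      integral_prod_symm _ hi2, ← integral_add hin (grBM_integrable hact _ hV x)]
    congr 1
    funext h
    rw [← (int_add_sq hσmeas N hNσ μ hN1 hN2 hdrift (h • x) (σ h x)).2.2]
    simp only [hcoc, add_comm]

lemma exists_corrector {σ : G → X → ℝ} (hact : Measurable fun p : G × X => p.1 • p.2)
    (hσmeas : Measurable fun p : G × X => σ p.1 p.2)
    (hcoc : ∀ g₁ g₂ : G, ∀ x : X, σ (g₂ * g₁) x = σ g₂ (g₁ • x) + σ g₁ x)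
    (N : G → ℝ) (hNσ : ∀ g x, |σ g x| ≤ N g)
    (μ : Measure G) [IsProbabilityMeasure μ] (hN1 : Integrable N μ)
    (hN2 : Integrable (fun g => N g ^ 2) μ)
    (hdrift : ∀ x, ∫ g, σ g x ∂μ = 0)
    (A : ℝ) (hApos : 0 < A)
    (hA : ∀ ε > (0 : ℝ), ∃ n₀ : ℕ, ∀ n ≥ n₀, ∀ x : X,
      |(n : ℝ)⁻¹ * (∫ g, (σ g x) ^ 2 ∂convPow μ n) - A| < ε) :
    ∃ h : X → ℝ, grBM h ∧ ∀ x, h x + A / 2 ≤ (∫ g, σ g x ^ 2 ∂μ) + ∫ g, h (g • x) ∂μ := by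
  set V : X → ℝ := fun x => ∫ g, σ g x ^ 2 ∂μ with hVdef
  have hV : grBM V := grBM_V hσmeas N hNσ μ hN2
  obtain ⟨n₀, hn₀⟩ := hA (A / 2) (by linarith)
  set p := max n₀ 1 with hp
  have hp1 : (0:ℝ) < p := by exact_mod_cast (lt_of_lt_of_le one_pos (le_max_right n₀ 1))
  have hu : ∀ i, grBM ((grOp μ)^[i] V) := by
    intro i
    induction i with
    | zero => exact hV
    | succ i ih => rw [Function.iterate_succ_apply']; exact grBM_op hact μ ih
  have hsum : ∀ (s : Finset ℕ) (f : ℕ → X → ℝ), (∀ i, grBM (f i)) →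
      grBM (fun x => ∑ i ∈ s, f i x) := by
    intro s f hf
    refine ⟨Finset.measurable_fun_sum s fun i _ => (hf i).1, ?_⟩
    choose C hC using fun i => (hf i).2
    exact ⟨∑ i ∈ s, C i, fun x => (Finset.abs_sum_le_sum_abs _ _).trans
      (Finset.sum_le_sum fun i _ => hC i x)⟩
  set S : ℕ → X → ℝ := fun n x => ∑ i ∈ Finset.range n, ((grOp μ)^[i] V) x with hS
  have hSB : ∀ n, grBM (S n) := fun n => hsum _ _ hu
  have hPS : ∀ n x, ∫ g, S n (g • x) ∂μ = S (n+1) x - V x := by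
    intro n x
    simp only [hS]
    rw [integral_finsetSum _ fun i _ => grBM_integrable hact μ (hu i) x, Finset.sum_range_succ']
    simp only [Function.iterate_succ_apply', Function.iterate_zero, id]
    simp [grOp]
  refine ⟨fun x => (p:ℝ)⁻¹ * ∑ j ∈ Finset.range p, S (j+1) x, ?_, ?_⟩
  · have := hsum (Finset.range p) (fun j => S (j+1)) fun j => hSB _
    obtain ⟨h1, C, hC⟩ := this
    refine ⟨h1.const_mul _, (p:ℝ)⁻¹ * C, fun x => ?_⟩
    rw [abs_mul, abs_of_pos (inv_pos.2 hp1)]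
    exact mul_le_mul_of_nonneg_left (hC x) (inv_pos.2 hp1).le
  · intro x
    have e1 : ∫ g, (p:ℝ)⁻¹ * ∑ j ∈ Finset.range p, S (j+1) (g • x) ∂μ =
        (p:ℝ)⁻¹ * ∑ j ∈ Finset.range p, (S (j+1+1) x - V x) := by
      rw [integral_const_mul, integral_finsetSum _ fun i _ => grBM_integrable hact μ (hSB _) x]
      simp only [hPS]
    have e2 : ∑ j ∈ Finset.range p, (S (j+1+1) x - V x) - ∑ j ∈ Finset.range p, S (j+1) x =
        S (p+1) x - S 1 x - p * V x := by
      have := Finset.sum_range_sub (fun j => S (j+1) x) p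
      simp only [Finset.sum_sub_distrib] at this ⊢
      simp at this ⊢
      linarith
    have e3 : S 1 x = V x := by simp [hS]
    have e4 : A / 2 ≤ (p:ℝ)⁻¹ * (S (p+1) x - V x) := by
      rw [← hPS, ← integral_const_mul]
      have : ∫ g : G, A / 2 ∂μ = A / 2 := by simp
      rw [← this]
      refine integral_mono (integrable_const _) ((grBM_integrable hact μ (hSB p) x).const_mul _) ?_
      intro g
      have := hn₀ p (le_max_left _ _) (g • x)
      rw [convPow_sq hact hσmeas hcoc N hNσ μ hN1 hN2 hdrift] at this
      have := (abs_lt.1 this).1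
      simp only [hS, hVdef]
      linarith
    rw [e1]
    have e5 : (p:ℝ)⁻¹ * (p * V x) = V x := by field_simp
    have e6 : (p:ℝ)⁻¹ * ∑ j ∈ Finset.range p, (S (j+1+1) x - V x) -
      (p:ℝ)⁻¹ * ∑ j ∈ Finset.range p, S (j+1) x = (p:ℝ)⁻¹ * (S (p+1) x - V x) - V x := by
      rw [← mul_sub, e2, e3, mul_sub, e5]
    linarith

end GR2

section GR3

variable {G : Type*} [Group G] [MeasurableSpace G] [MeasurableMul₂ G]
  {X : Type*} [MetricSpace X] [CompactSpace X] [MeasurableSpace X] [BorelSpace X] [MulAction G X]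

/-- Distance to the interval. -/
def grD (a l t : ℝ) : ℝ := max 0 (max (t - l) (-a - t))

/-- Truncated squared overshoot. -/
def grPhi (a l r t : ℝ) : ℝ := (max (grD a l t - r) 0) ^ 2

/-- Truncated second moment. -/
def grEps (N : G → ℝ) (μ : Measure G) (r : ℝ) : ℝ := ∫ g, (max (N g - r) 0) ^ 2 ∂μ

lemma measurable_grD (a l : ℝ) : Measurable (grD a l) := by unfold grD; fun_prop

lemma measurable_grPhi (a l r : ℝ) : Measurable (grPhi a l r) := by
  unfold grPhi
  have := measurable_grD a l
  fun_prop

lemma grD_nonneg (a l t : ℝ) : 0 ≤ grD a l t := le_max_left _ _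

lemma grD_le {a l : ℝ} (ha : 0 < a) (hl : 0 < l) (t : ℝ) : grD a l t ≤ |t| := by
  unfold grD
  refine max_le (abs_nonneg _) (max_le ?_ ?_)
  · linarith [le_abs_self t]
  · linarith [neg_abs_le t]

lemma grPhi_le {a l r : ℝ} (ha : 0 < a) (hl : 0 < l) (hr : 0 ≤ r) (t : ℝ) :
    grPhi a l r t ≤ t ^ 2 := by
  unfold grPhi
  rw [← sq_abs t]
  refine pow_le_pow_left₀ (le_max_right _ _) (max_le ?_ (abs_nonneg _)) 2
  linarith [grD_le ha hl t]

lemma grPhi_nonneg (a l r t : ℝ) : 0 ≤ grPhi a l r t := sq_nonneg _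

lemma grPhi_alive {a l r t : ℝ} (hr : 0 ≤ r) (ht : t ∈ Set.Ioo (-a) l) : grPhi a l r t = 0 := by
  have : grD a l t = 0 := by
    unfold grD
    exact max_eq_left (max_le (by linarith [ht.2]) (by linarith [ht.1]))
  unfold grPhi
  rw [this, max_eq_right (by linarith)]; simp

lemma grPhi_step {a l r t u M : ℝ} (ht : t ∈ Set.Ioo (-a) l) (hM : |u| ≤ M) :
    grPhi a l r (t + u) ≤ (max (M - r) 0) ^ 2 := by
  unfold grPhi
  refine pow_le_pow_left₀ (le_max_right _ _) (max_le_max ?_ le_rfl) 2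
  have : grD a l (t + u) ≤ M := by
    unfold grD
    refine max_le ((abs_nonneg _).trans hM) (max_le ?_ ?_)
    · linarith [le_abs_self u, ht.2]
    · linarith [neg_abs_le u, ht.1]
  linarith

lemma sq_le_grPhi {a l r : ℝ} (ha : 0 < a) (hl : 0 < l) (hr : 0 ≤ r) (t : ℝ) :
    t ^ 2 ≤ 2 * (a + l + r) ^ 2 + 2 * grPhi a l r t := by
  unfold grPhi
  have h1 : |t| ≤ (a + l + r) + max (grD a l t - r) 0 := by
    have : |t| ≤ a + l + grD a l t := by
      unfold grD
      rw [abs_le]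
      constructor
      · linarith [(le_max_right (t - l) (-a - t)).trans (le_max_right 0 _)]
      · linarith [(le_max_left (t - l) (-a - t)).trans (le_max_right 0 _)]
    linarith [le_max_left (grD a l t - r) 0]
  have h2 : t ^ 2 ≤ ((a + l + r) + max (grD a l t - r) 0) ^ 2 := by
    rw [← sq_abs]; exact pow_le_pow_left₀ (abs_nonneg _) h1 2
  nlinarith [sq_nonneg ((a + l + r) - max (grD a l t - r) 0)]

lemma grD_le_grPhi {a l r : ℝ} (hr : 0 < r) (t : ℝ) :
    grD a l t ≤ 2 * r + grPhi a l r t / r := by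
  unfold grPhi
  set z := max (grD a l t - r) 0
  have h1 : grD a l t - r ≤ z := le_max_left _ _
  have h2 : z ≤ r + z ^ 2 / r := by
    have : r + z ^ 2 / r - z = ((r - z) ^ 2 + r * z) / r := by field_simp; ring
    have h0 : 0 ≤ z := le_max_right _ _
    have : 0 ≤ r + z ^ 2 / r - z := by rw [this]; positivity
    linarith
  linarith

lemma integrable_grEps (N : G → ℝ) (hN0 : ∀ g, 0 ≤ N g) (μ : Measure G)
    (hN1 : Integrable N μ) (hN2 : Integrable (fun g => N g ^ 2) μ) {r : ℝ} (hr : 0 ≤ r) :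
    Integrable (fun g => (max (N g - r) 0) ^ 2) μ := by
  refine Integrable.mono' hN2 ?_ (ae_of_all _ fun g => ?_)
  · exact ((hN1.aestronglyMeasurable.sub aestronglyMeasurable_const).sup
      aestronglyMeasurable_const).pow 2
  · rw [Real.norm_eq_abs, abs_sq]
    exact pow_le_pow_left₀ (le_max_right _ _) (max_le (by linarith) (hN0 g)) 2

lemma tendsto_grEps (N : G → ℝ) (hN0 : ∀ g, 0 ≤ N g) (μ : Measure G)
    (hN1 : Integrable N μ) (hN2 : Integrable (fun g => N g ^ 2) μ) :
    Tendsto (grEps N μ) atTop (𝓝 0) := by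
  have h0 : (0:ℝ) = ∫ g : G, (0:ℝ) ∂μ := by simp
  rw [h0]
  unfold grEps
  refine tendsto_integral_filter_of_dominated_convergence (fun g => N g ^ 2) ?_ ?_ hN2 ?_
  · filter_upwards [eventually_ge_atTop 0] with r hr
    exact (integrable_grEps N hN0 μ hN1 hN2 hr).aestronglyMeasurable
  · filter_upwards [eventually_ge_atTop 0] with r hr
    refine ae_of_all _ fun g => ?_
    rw [Real.norm_eq_abs, abs_sq]
    exact pow_le_pow_left₀ (le_max_right _ _) (max_le (by linarith) (hN0 g)) 2
  · refine ae_of_all _ fun g => ?_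
    refine tendsto_const_nhds.congr' ?_
    filter_upwards [eventually_ge_atTop (N g)] with r hr
    rw [max_eq_right (by linarith)]; simp

lemma grPhi_law {σ : G → X → ℝ} (hact : Measurable fun p : G × X => p.1 • p.2)
    (hσmeas : Measurable fun p : G × X => σ p.1 p.2) {a l : ℝ} (ha : 0 < a) (hl : 0 < l)
    (μ : Measure G) [IsProbabilityMeasure μ] (N : G → ℝ) (hN0 : ∀ g, 0 ≤ N g)
    (hNσ : ∀ g x, |σ g x| ≤ N g) (hN1 : Integrable N μ)
    (hN2 : Integrable (fun g => N g ^ 2) μ) (x : X) {r : ℝ} (hr : 0 ≤ r) (n : ℕ) :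
    ∫ s, grPhi a l r s.2 ∂grLaw σ a l μ x n ≤ grEps N μ r *
      ∑ i ∈ Finset.range n, (grLaw σ a l μ x i).real {s | s.2 ∈ Set.Ioo (-a) l} := by
  have hm : Measurable fun s : X × ℝ => grPhi a l r s.2 :=
    (measurable_grPhi a l r).comp measurable_snd
  induction n with
  | zero =>
    simp only [grLaw]
    rw [integral_dirac' _ _ hm.stronglyMeasurable,
      grPhi_alive hr ⟨by simpa using ha, by simpa using hl⟩]
    simp
  | succ n ih =>
    have := drift_grLaw hact hσmeas a l μ N hNσ hN2 x n (fun s => - grPhi a l r s.2) hm.neg 1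
      (fun s => by
        rw [abs_neg, abs_of_nonneg (grPhi_nonneg _ _ _ _)]
        linarith [grPhi_le ha hl hr s.2])
      (- grEps N μ r) (fun y t ht => by
        simp only
        rw [grPhi_alive hr ht, integral_neg, neg_zero, zero_add, neg_le_neg_iff]
        exact integral_mono_of_nonneg (ae_of_all _ fun g => grPhi_nonneg _ _ _ _)
          (integrable_grEps N hN0 μ hN1 hN2 hr) (ae_of_all _ fun g => grPhi_step ht (hNσ g y)))
    rw [integral_neg, integral_neg] at this
    rw [Finset.sum_range_succ, mul_add]
    linarith

lemma mean_law {σ : G → X → ℝ} (hact : Measurable fun p : G × X => p.1 • p.2)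
    (hσmeas : Measurable fun p : G × X => σ p.1 p.2) (a l : ℝ)
    (μ : Measure G) [IsProbabilityMeasure μ] (N : G → ℝ)
    (hNσ : ∀ g x, |σ g x| ≤ N g) (hN1 : Integrable N μ)
    (hN2 : Integrable (fun g => N g ^ 2) μ)
    (hdrift : ∀ x, ∫ g, σ g x ∂μ = 0) (x : X) (n : ℕ) :
    ∫ s, s.2 ∂grLaw σ a l μ x n = 0 := by
  have hb : ∀ s : X × ℝ, |s.2| ≤ 1 * (1 + s.2 ^ 2) := fun s => by
    rw [← sq_abs]; nlinarith [sq_nonneg (|s.2| - 1), abs_nonneg s.2]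
  have hi : ∀ y, Integrable (fun g => σ g y) μ := fun y =>
    (int_add_sq hσmeas N hNσ μ hN1 hN2 hdrift y 0).1
  have he : ∀ y (t : ℝ), ∫ g, (t + σ g y) ∂μ = t := fun y t => by
    rw [integral_add (integrable_const _) (hi y), hdrift]; simp
  induction n with
  | zero =>
    simp only [grLaw]
    rw [integral_dirac' _ _ measurable_snd.stronglyMeasurable]
  | succ n ih =>
    have h1 := drift_grLaw hact hσmeas a l μ N hNσ hN2 x n (fun s => s.2) measurable_snd 1 hb 0
      (fun y t ht => by simp only; rw [he]; simp)
    have h2 := drift_grLaw hact hσmeas a l μ N hNσ hN2 x n (fun s => - s.2) measurable_snd.neg 1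
      (fun s => by rw [abs_neg]; exact hb s) 0
      (fun y t ht => by simp only; rw [integral_neg, he]; simp)
    rw [integral_neg, integral_neg] at h2
    linarith

lemma sum_alive {σ : G → X → ℝ} (hact : Measurable fun p : G × X => p.1 • p.2)
    (hσmeas : Measurable fun p : G × X => σ p.1 p.2) {a l : ℝ} (ha : 0 < a) (hl : 0 < l)
    (μ : Measure G) [IsProbabilityMeasure μ] (N : G → ℝ) (hN0 : ∀ g, 0 ≤ N g)
    (hNσ : ∀ g x, |σ g x| ≤ N g) (hN1 : Integrable N μ)
    (hN2 : Integrable (fun g => N g ^ 2) μ)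
    (hdrift : ∀ x, ∫ g, σ g x ∂μ = 0) (x : X)
    (A : ℝ) (hApos : 0 < A) (h : X → ℝ) (hm : Measurable h) (C : ℝ) (hC : ∀ x, |h x| ≤ C)
    (hh : ∀ x, h x + A / 2 ≤ (∫ g, σ g x ^ 2 ∂μ) + ∫ g, h (g • x) ∂μ)
    {r : ℝ} (hr : 0 ≤ r) (hrA : grEps N μ r ≤ A / 8) (n : ℕ) :
    ∑ i ∈ Finset.range n, (grLaw σ a l μ x i).real {s | s.2 ∈ Set.Ioo (-a) l} ≤
      4 / A * (2 * (a + l + r) ^ 2 + 2 * C) := by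
  set Sg := ∑ i ∈ Finset.range n, (grLaw σ a l μ x i).real {s | s.2 ∈ Set.Ioo (-a) l} with hSg
  have hC0 : 0 ≤ C := (abs_nonneg _).trans (hC x)
  have hSg0 : 0 ≤ Sg := Finset.sum_nonneg fun i _ => measureReal_nonneg
  have hFm : Measurable fun s : X × ℝ => s.2 ^ 2 + h s.1 := by fun_prop
  have hFb : ∀ s : X × ℝ, |s.2 ^ 2 + h s.1| ≤ (1 + C) * (1 + s.2 ^ 2) := fun s => by
    refine (abs_add_le _ _).trans ?_
    rw [abs_sq]
    nlinarith [hC s.1, mul_nonneg hC0 (sq_nonneg s.2)]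
  have hF : ∀ n, (x, (0:ℝ)).2 ^ 2 + h x + A / 2 *
      ∑ i ∈ Finset.range n, (grLaw σ a l μ x i).real {s | s.2 ∈ Set.Ioo (-a) l} ≤
      ∫ s, (s.2 ^ 2 + h s.1) ∂grLaw σ a l μ x n := by
    intro n
    induction n with
    | zero =>
      simp only [grLaw]
      rw [integral_dirac' _ _ hFm.stronglyMeasurable]
      simp
    | succ n ih =>
      have := drift_grLaw hact hσmeas a l μ N hNσ hN2 x n _ hFm (1 + C) hFb (A / 2)
        (fun y t ht => by
          simp only
          obtain ⟨-, i2, e2⟩ := int_add_sq hσmeas N hNσ μ hN1 hN2 hdrift y t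
          rw [integral_add i2 (grBM_integrable hact μ ⟨hm, C, hC⟩ y), e2]
          linarith [hh y])
      rw [Finset.sum_range_succ, mul_add]
      linarith
  have hp := isProb_grLaw hact hσmeas a l μ x n
  have hphi := grPhi_law hact hσmeas ha hl μ N hN0 hNσ hN1 hN2 x hr n
  have hiphi := integrable_grLaw hact hσmeas a l μ N hNσ hN2 x n (fun s => grPhi a l r s.2)
    ((measurable_grPhi a l r).comp measurable_snd) 1 (fun s => by
        rw [abs_of_nonneg (grPhi_nonneg _ _ _ _)]
        linarith [grPhi_le ha hl hr s.2])
  have hup : ∫ s, (s.2 ^ 2 + h s.1) ∂grLaw σ a l μ x n ≤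
      ∫ s, ((2 * (a + l + r) ^ 2 + C) + 2 * grPhi a l r s.2) ∂grLaw σ a l μ x n := by
    refine integral_mono (integrable_grLaw hact hσmeas a l μ N hNσ hN2 x n _ hFm _ hFb)
      ((integrable_const _).add (hiphi.const_mul 2)) fun s => ?_
    have := sq_le_grPhi ha hl hr s.2
    simp only
    linarith [(le_abs_self _).trans (hC s.1)]
  rw [integral_add (integrable_const _) (hiphi.const_mul 2), integral_const_mul] at hup
  simp only [integral_const, probReal_univ, one_smul] at hup
  have := hF n
  rw [← hSg] at this hphi
  have hle : grEps N μ r * Sg ≤ A / 8 * Sg := mul_le_mul_of_nonneg_right hrA hSg0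
  have hhx := (abs_le.1 (hC x)).1
  have key : A / 4 * Sg ≤ 2 * (a + l + r) ^ 2 + 2 * C := by
    simp only at this
    linarith
  calc Sg = 4 / A * (A / 4 * Sg) := by field_simp
    _ ≤ _ := mul_le_mul_of_nonneg_left key (by positivity)

lemma core_bound {σ : G → X → ℝ} (hact : Measurable fun p : G × X => p.1 • p.2)
    (hσmeas : Measurable fun p : G × X => σ p.1 p.2) {a l : ℝ} (ha : 0 < a) (hl : 0 < l)
    (μ : Measure G) [IsProbabilityMeasure μ] (N : G → ℝ) (hN0 : ∀ g, 0 ≤ N g)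
    (hNσ : ∀ g x, |σ g x| ≤ N g) (hN1 : Integrable N μ)
    (hN2 : Integrable (fun g => N g ^ 2) μ)
    (hdrift : ∀ x, ∫ g, σ g x ∂μ = 0) (x : X) (B : ℝ)
    (hB : ∀ n, ∑ i ∈ Finset.range n, (grLaw σ a l μ x i).real {s | s.2 ∈ Set.Ioo (-a) l} ≤ B)
    {r : ℝ} (hr : 0 < r) (P : ℝ)
    (hP : Tendsto (fun n => (grLaw σ a l μ x n).real {s | l ≤ s.2}) atTop (𝓝 P)) :
    |a - (a + l) * P| ≤ 2 * r + grEps N μ r * B / r := by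
  set α := fun n => (grLaw σ a l μ x n).real {s | s.2 ∈ Set.Ioo (-a) l} with hα
  have hα0 : Tendsto α atTop (𝓝 0) :=
    (summable_of_sum_range_le (fun n => measureReal_nonneg) hB).tendsto_atTop_zero
  have hbound : ∀ n, |a - (a + l) * (grLaw σ a l μ x n).real {s | l ≤ s.2}| ≤
      2 * r + grEps N μ r * B / r + (a + l) * α n := by
    intro n
    have hp := isProb_grLaw hact hσmeas a l μ x n
    have hJ : MeasurableSet {s : X × ℝ | s.2 ∈ Set.Ioo (-a) l} :=
      measurable_snd measurableSet_Ioo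
    have hL : MeasurableSet {s : X × ℝ | l ≤ s.2} := measurable_snd measurableSet_Ici
    have hphi := grPhi_law hact hσmeas ha hl μ N hN0 hNσ hN1 hN2 x hr.le n
    have hiphi := integrable_grLaw hact hσmeas a l μ N hNσ hN2 x n (fun s => grPhi a l r s.2)
      ((measurable_grPhi a l r).comp measurable_snd) 1 (fun s => by
          rw [abs_of_nonneg (grPhi_nonneg _ _ _ _)]
          linarith [grPhi_le ha hl hr.le s.2])
    have hit := integrable_grLaw hact hσmeas a l μ N hNσ hN2 x n (fun s => s.2)
      measurable_snd 1 (fun s => by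
        rw [← sq_abs]; nlinarith [sq_nonneg (|s.2| - 1), abs_nonneg s.2])
    have iJ : Integrable (Set.indicator {s : X × ℝ | s.2 ∈ Set.Ioo (-a) l} fun _ => a + l)
      (grLaw σ a l μ x n) := (integrable_const _).indicator hJ
    have iL : Integrable (Set.indicator {s : X × ℝ | l ≤ s.2} fun _ => a + l)
      (grLaw σ a l μ x n) := (integrable_const _).indicator hL
    have ita : Integrable (fun s : X × ℝ => s.2 + a) (grLaw σ a l μ x n) :=
      hit.add (integrable_const _)
    have e1 : a - (a + l) * (grLaw σ a l μ x n).real {s | l ≤ s.2} =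
        ∫ s, ((s.2 + a) - Set.indicator {s : X × ℝ | l ≤ s.2} (fun _ => a + l) s)
          ∂grLaw σ a l μ x n := by
      rw [integral_sub ita iL, integral_add hit (integrable_const _),
        mean_law hact hσmeas a l μ N hNσ hN1 hN2 hdrift, integral_indicator_const _ hL]
      simp [mul_comm]
    have ir : Integrable (fun s : X × ℝ => 2 * r + grPhi a l r s.2 / r) (grLaw σ a l μ x n) :=
      (integrable_const _).add (hiphi.div_const r)
    have e2 : ∫ s, ((2 * r + grPhi a l r s.2 / r) +
        Set.indicator {s : X × ℝ | s.2 ∈ Set.Ioo (-a) l} (fun _ => a + l) s)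
          ∂grLaw σ a l μ x n = 2 * r + (∫ s, grPhi a l r s.2 ∂grLaw σ a l μ x n) / r
          + (a + l) * α n := by
      rw [integral_add ir iJ, integral_add (integrable_const _) (hiphi.div_const r),
        integral_div, integral_indicator_const _ hJ]
      simp [mul_comm, hα]
    have e3 : (∫ s, grPhi a l r s.2 ∂grLaw σ a l μ x n) / r ≤ grEps N μ r * B / r := by
      refine div_le_div_of_nonneg_right (hphi.trans ?_) hr.le
      exact mul_le_mul_of_nonneg_left (hB n) (integral_nonneg fun g => sq_nonneg _)
    rw [e1]
    refine le_trans (b := 2 * r + (∫ s, grPhi a l r s.2 ∂grLaw σ a l μ x n) / r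
          + (a + l) * α n) ?_ (by linarith)
    rw [← e2, ← Real.norm_eq_abs]
    refine norm_integral_le_of_norm_le (ir.add iJ) (ae_of_all _ fun s => ?_)
    have hD := grD_le_grPhi (a := a) (l := l) hr s.2
    have hD0 := grD_nonneg a l s.2
    have hD1 : s.2 - l ≤ grD a l s.2 := (le_max_left _ _).trans (le_max_right _ _)
    have hD2 : -a - s.2 ≤ grD a l s.2 := (le_max_right _ _).trans (le_max_right _ _)
    rw [Real.norm_eq_abs]
    by_cases h1 : l ≤ s.2
    · rw [Set.indicator_of_mem (by exact h1),
        Set.indicator_of_notMem (by simp only [Set.mem_setOf_eq, Set.mem_Ioo]; intro h; linarith)]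
      rw [abs_le]; constructor <;> linarith
    · rw [Set.indicator_of_notMem (by exact h1)]
      push Not at h1
      by_cases h2 : -a < s.2
      · rw [Set.indicator_of_mem (by exact ⟨h2, h1⟩)]
        rw [abs_le]; constructor <;> linarith
      · rw [Set.indicator_of_notMem (by simp only [Set.mem_setOf_eq, Set.mem_Ioo]; intro h; exact h2 h.1)]
        push Not at h2
        rw [abs_le]; constructor <;> linarith
  have t1 : Tendsto (fun n => |a - (a + l) * (grLaw σ a l μ x n).real {s | l ≤ s.2}|) atTop
      (𝓝 |a - (a + l) * P|) := ((hP.const_mul (a + l)).const_sub a).abs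
  have t2 : Tendsto (fun n => 2 * r + grEps N μ r * B / r + (a + l) * α n) atTop
      (𝓝 (2 * r + grEps N μ r * B / r + (a + l) * 0)) := (hα0.const_mul _).const_add _
  have := le_of_tendsto_of_tendsto' t1 t2 hbound
  simpa using this

end GR3

section GR4

variable {G : Type*} [Group G] [MeasurableSpace G] [MeasurableMul₂ G]
  {X : Type*} [MetricSpace X] [CompactSpace X] [MeasurableSpace X] [BorelSpace X] [MulAction G X]

lemma grPath_alive {σ : G → X → ℝ}
    (hcoc : ∀ g₁ g₂ : G, ∀ x : X, σ (g₂ * g₁) x = σ g₂ (g₁ • x) + σ g₁ x)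
    (a l : ℝ) (x : X) (b : ℕ → G) (n : ℕ)
    (h : ∀ m < n, σ (prodRev b m) x ∈ Set.Ioo (-a) l) :
    grPath σ a l x b n = (prodRev b n • x, σ (prodRev b n) x) := by
  have h1 : σ 1 x = 0 := by
    have := hcoc 1 1 x
    simpa using this
  induction n with
  | zero => simp [grPath, prodRev, h1]
  | succ n ih =>
    have hn := h n (Nat.lt_succ_self n)
    simp only [grPath, ih fun m hm => h m (hm.trans (Nat.lt_succ_self n)), grStep, if_pos hn,
      prodRev, hcoc, mul_smul]
    rw [add_comm]

lemma grPath_exists {σ : G → X → ℝ}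
    (hcoc : ∀ g₁ g₂ : G, ∀ x : X, σ (g₂ * g₁) x = σ g₂ (g₁ • x) + σ g₁ x)
    (a l : ℝ) (x : X) (b : ℕ → G) (n : ℕ) :
    ∃ m, grPath σ a l x b n = (prodRev b m • x, σ (prodRev b m) x) ∧
      (∀ j < m, σ (prodRev b j) x ∈ Set.Ioo (-a) l) ∧
      (m = n ∨ σ (prodRev b m) x ∉ Set.Ioo (-a) l) := by
  induction n with
  | zero => exact ⟨0, grPath_alive hcoc a l x b 0 (by simp), by simp, Or.inl rfl⟩
  | succ n ih =>
    obtain ⟨m, e, hm, hs⟩ := ih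
    by_cases hJ : σ (prodRev b m) x ∈ Set.Ioo (-a) l
    · have hm' : ∀ j < m + 1, σ (prodRev b j) x ∈ Set.Ioo (-a) l := by
        intro j hj
        rcases Nat.lt_succ_iff_lt_or_eq.1 hj with h | h
        · exact hm j h
        · rw [h]; exact hJ
      rcases hs with rfl | hs
      · exact ⟨m + 1, grPath_alive hcoc a l x b (m + 1) hm', hm', Or.inl rfl⟩
      · exact absurd hJ hs
    · refine ⟨m, ?_, hm, Or.inr hJ⟩
      simp only [grPath, e, grStep, if_neg hJ]

lemma event_eq {σ : G → X → ℝ}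
    (hcoc : ∀ g₁ g₂ : G, ∀ x : X, σ (g₂ * g₁) x = σ g₂ (g₁ • x) + σ g₁ x)
    {a l : ℝ} (ha : 0 < a) (hl : 0 < l) (x : X) :
    {b : ℕ → G | ∃ n : ℕ, 1 ≤ n ∧ l ≤ σ (prodRev b n) x ∧
        ∀ m : ℕ, 1 ≤ m → m < n → -a < σ (prodRev b m) x} =
      ⋃ n, {b | l ≤ (grPath σ a l x b n).2} := by
  have h1 : σ 1 x = 0 := by
    have := hcoc 1 1 x
    simpa using this
  ext b
  simp only [Set.mem_setOf_eq, Set.mem_iUnion]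
  constructor
  · rintro ⟨n, hn, hln, hm⟩
    classical
    have hex : ∃ n, l ≤ σ (prodRev b n) x := ⟨n, hln⟩
    refine ⟨Nat.find hex, ?_⟩
    rw [grPath_alive hcoc]
    · exact Nat.find_spec hex
    · intro m hmlt
      have hlt := lt_of_not_ge (Nat.find_min hex hmlt)
      refine ⟨?_, hlt⟩
      rcases Nat.eq_zero_or_pos m with rfl | h0
      · simp only [prodRev, h1]; linarith
      · exact hm m h0 (lt_of_lt_of_le hmlt (Nat.find_min' hex hln))
  · rintro ⟨n, hn⟩
    obtain ⟨m, e, hm, -⟩ := grPath_exists hcoc a l x b n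
    rw [e] at hn
    refine ⟨m, ?_, hn, fun j _ hj => (hm j hj).1⟩
    rcases Nat.eq_zero_or_pos m with rfl | h0
    · simp only [prodRev, h1] at hn; linarith
    · exact h0

lemma tendsto_event {σ : G → X → ℝ} (hact : Measurable fun p : G × X => p.1 • p.2)
    (hσmeas : Measurable fun p : G × X => σ p.1 p.2)
    (hcoc : ∀ g₁ g₂ : G, ∀ x : X, σ (g₂ * g₁) x = σ g₂ (g₁ • x) + σ g₁ x)
    (μ : Measure G) [IsProbabilityMeasure μ]
    (β : Measure (ℕ → G)) [IsProbabilityMeasure β]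
    (hβ : ∀ n : ℕ, β.map (fun b (i : Fin n) => b i) = Measure.pi fun _ : Fin n => μ)
    {a l : ℝ} (ha : 0 < a) (hl : 0 < l) (x : X) :
    Tendsto (fun n => (grLaw σ a l μ x n).real {s | l ≤ s.2}) atTop
      (𝓝 (β {b : ℕ → G | ∃ n : ℕ, 1 ≤ n ∧ l ≤ σ (prodRev b n) x ∧
        ∀ m : ℕ, 1 ≤ m → m < n → -a < σ (prodRev b m) x}).toReal) := by
  rw [event_eq hcoc ha hl]
  have hmono : Monotone fun n => {b : ℕ → G | l ≤ (grPath σ a l x b n).2} := by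
    refine monotone_nat_of_le_succ fun n b hb => ?_
    have hb' : l ≤ (grPath σ a l x b n).2 := hb
    have : (grPath σ a l x b n).2 ∉ Set.Ioo (-a) l := fun h => by linarith [h.2]
    simp only [Set.mem_setOf_eq, grPath, grStep, if_neg this]
    exact hb'
  have := (ENNReal.tendsto_toReal (measure_ne_top β _)).comp
    (tendsto_measure_iUnion_atTop (μ := β) hmono)
  refine this.congr fun n => ?_
  have hL : MeasurableSet {s : X × ℝ | l ≤ s.2} := measurable_snd measurableSet_Ici
  have hr : Measurable fun (b : ℕ → G) (i : Fin n) => b i := by fun_prop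
  have hF := measurable_grFin hact hσmeas a l x n
  rw [← map_grFin hact hσmeas, ← hβ, Measure.map_map hF hr, Measure.real,
    Measure.map_apply (hF.comp hr) hL]
  simp only [Function.comp, grPath_eq_grFin]
  rfl

end GR4

/-- gambler's ruin estimate. -/
theorem gamblers_ruin
    {G : Type*} [Group G] [MeasurableSpace G] [MeasurableMul₂ G]
    {X : Type*} [MetricSpace X] [CompactSpace X] [MeasurableSpace X] [BorelSpace X]
    [MulAction G X] (hact : Measurable fun p : G × X => p.1 • p.2)
    (σ : G → X → ℝ)
    (hσmeas : Measurable fun p : G × X => σ p.1 p.2)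
    (hcoc : ∀ g₁ g₂ : G, ∀ x : X, σ (g₂ * g₁) x = σ g₂ (g₁ • x) + σ g₁ x)
    (N : G → ℝ) (hN0 : ∀ g, 0 ≤ N g) (hNsub : ∀ g h : G, N (g * h) ≤ N g + N h)
    (hNσ : ∀ g x, |σ g x| ≤ N g)
    (μ : Measure G) [IsProbabilityMeasure μ]
    (hmom1 : Integrable N μ)
    (hdrift : ∀ x, ∫ g, σ g x ∂μ = 0)
    (hexp : ∃ s > (0 : ℝ), Integrable (fun g => Real.exp (s * N g)) μ)
    (hcont : ∀ g, Continuous (σ g))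
    (hXctrl : ∀ ε > (0 : ℝ), ∃ R > (0 : ℝ), ∀ n : ℕ, 1 ≤ n → ∀ x y : X,
      ENNReal.ofReal (1 - ε) ≤ convPow μ n {g | |σ g x - σ g y| ≤ R})
    (A : ℝ) (hApos : 0 < A)
    (hA : ∀ ε > (0 : ℝ), ∃ n₀ : ℕ, ∀ n ≥ n₀, ∀ x : X,
      |(n : ℝ)⁻¹ * (∫ g, (σ g x) ^ 2 ∂convPow μ n) - A| < ε)
    (β : Measure (ℕ → G)) [IsProbabilityMeasure β]
    (hβ : ∀ n : ℕ, β.map (fun b (i : Fin n) => b i) = Measure.pi fun _ : Fin n => μ)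
    (k l : ℝ) (hk : 0 < k) (hl : 0 < l) (ks ls : ℝ → ℝ)
    (hks : Tendsto (fun s => ks s / s) atTop (𝓝 k))
    (hls : Tendsto (fun s => ls s / s) atTop (𝓝 l)) :
    ∀ x : X,
      Tendsto (fun s : ℝ =>
          (β {b | ∃ n : ℕ, 1 ≤ n ∧ ls s ≤ σ (prodRev b n) x ∧
              ∀ m : ℕ, 1 ≤ m → m < n → -(ks s) < σ (prodRev b m) x}).toReal)
        atTop (𝓝 (k / (k + l))) := by
  intro x
  obtain ⟨e, he, hexpi⟩ := hexp
  have hN2 : Integrable (fun g => N g ^ 2) μ := by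
    refine Integrable.mono' (hexpi.const_mul (2 / e ^ 2))
      (hmom1.aestronglyMeasurable.pow 2) (ae_of_all _ fun g => ?_)
    rw [Real.norm_eq_abs, abs_sq]
    have h1 := Real.quadratic_le_exp_of_nonneg (mul_nonneg he.le (hN0 g))
    have h2 : (e * N g) ^ 2 / 2 ≤ Real.exp (e * N g) := by
      linarith [mul_nonneg he.le (hN0 g)]
    calc N g ^ 2 = 2 / e ^ 2 * ((e * N g) ^ 2 / 2) := by field_simp
      _ ≤ _ := mul_le_mul_of_nonneg_left h2 (by positivity)
  obtain ⟨h, ⟨hhm, C, hC⟩, hh⟩ :=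
    exists_corrector hact hσmeas hcoc N hNσ μ hmom1 hN2 hdrift A hApos hA
  have hεt := tendsto_grEps N hN0 μ hmom1 hN2
  obtain ⟨r₀, hr₀A, hr₀⟩ : ∃ r₀ : ℝ, grEps N μ r₀ ≤ A / 8 ∧ 0 ≤ r₀ :=
    ((hεt.eventually_le_const (u := A / 8) (by linarith)).and (eventually_ge_atTop 0)).exists
  set P : ℝ → ℝ := fun s => (β {b | ∃ n : ℕ, 1 ≤ n ∧ ls s ≤ σ (prodRev b n) x ∧
              ∀ m : ℕ, 1 ≤ m → m < n → -(ks s) < σ (prodRev b m) x}).toReal with hP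
  have hkpos : ∀ᶠ s in atTop, 0 < ks s := by
    filter_upwards [hks.eventually_const_lt hk, eventually_gt_atTop 0] with s h1 h2
    exact (div_pos_iff_of_pos_right h2).1 h1
  have hlpos : ∀ᶠ s in atTop, 0 < ls s := by
    filter_upwards [hls.eventually_const_lt hl, eventually_gt_atTop 0] with s h1 h2
    exact (div_pos_iff_of_pos_right h2).1 h1
  have hmain : ∀ δ > (0:ℝ), ∀ᶠ s in atTop, |(ks s - (ks s + ls s) * P s) / s| ≤
      2 * δ + grEps N μ (δ * s) / δ *
        (4 / A * (2 * (ks s / s + ls s / s + r₀ / s) ^ 2 + 2 * C / s ^ 2)) := by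
    intro δ hδ
    filter_upwards [hkpos, hlpos, eventually_gt_atTop 0] with s hk' hl' hs
    have := core_bound hact hσmeas hk' hl' μ N hN0 hNσ hmom1 hN2 hdrift x _
      (sum_alive hact hσmeas hk' hl' μ N hN0 hNσ hmom1 hN2 hdrift x A hApos h hhm C hC hh
        hr₀ hr₀A) (mul_pos hδ hs) (P s)
      (tendsto_event hact hσmeas hcoc μ β hβ hk' hl' x)
    rw [abs_div, abs_of_pos hs, div_le_iff₀ hs]
    refine this.trans (le_of_eq ?_)
    field_simp
  have hlim : Tendsto (fun s => (ks s - (ks s + ls s) * P s) / s) atTop (𝓝 0) := by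
    rw [Metric.tendsto_nhds]
    intro η hη
    have hδ : 0 < η / 4 := by linarith
    have t0 : Tendsto (fun s : ℝ => grEps N μ (η / 4 * s)) atTop (𝓝 0) :=
      hεt.comp (tendsto_id.const_mul_atTop hδ)
    have t1 : Tendsto (fun s : ℝ => r₀ / s) atTop (𝓝 0) := tendsto_id.const_div_atTop r₀
    have t2 : Tendsto (fun s : ℝ => 2 * C / s ^ 2) atTop (𝓝 0) :=
      (tendsto_pow_atTop two_ne_zero).const_div_atTop (2 * C)
    have t3 := ((t0.div_const (η / 4)).mul
      ((((((hks.add hls).add t1).pow 2).const_mul 2).add t2).const_mul (4 / A))).const_add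
        (2 * (η / 4))
    have hlt : 2 * (η / 4) + 0 / (η / 4) * (4 / A * (2 * (k + l + 0) ^ 2 + 0)) < η := by
      simp; linarith
    filter_upwards [hmain _ hδ, t3.eventually_lt_const hlt] with s h1 h2
    rw [Real.dist_eq, sub_zero]
    exact h1.trans_lt h2
  have hkl : k + l ≠ 0 := by positivity
  have hfin := (hks.sub hlim).div (hks.add hls) hkl
  rw [sub_zero] at hfin
  refine hfin.congr' ?_
  filter_upwards [hkpos, hlpos, eventually_gt_atTop 0] with s hk' hl' hs
  simp only [Pi.div_apply]
  have : ks s + ls s ≠ 0 := by positivity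
  field_simp
  ring
end
end
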